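/- arXiv:2309.01044 — 8 statements merged into one kernel-verified Lean document; each statement's English description precedes it below -/
import Mathlib

section
/- Let A be an abelian category and X a subcategory of A. The following are equivalent: (i) X is a KE-closed subcategory of A; (ii) X is a torsion-free class of the torsion-free closure F(X) (in the sense of extension-closed subcategories); (iii) there exists a torsion-free class F of A such that X is a torsion-free class of F. -/
/-!
Statement 0: For a subcategory `X` of an abelian category `A`, TFAE:
(i) `X` is a KE-closed subcategory of `A`;
(ii) `X` is a torsion-free class of its torsion-free closure `F(X)`;
(iii) there is a torsion-free class `F` of `A` such that `X` is a torsion-free class of `F`.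
-/

open CategoryTheory CategoryTheory.Limits

universe v u

variable {A : Type u} [Category.{v} A] [Abelian A]

/-- An additive subcategory: contains the zero objects and is closed under
isomorphisms and finite direct sums. -/
def IsAdditiveSubcat (P : A → Prop) : Prop :=
  (∀ Z : A, IsZero Z → P Z) ∧
  (∀ X Y : A, (X ≅ Y) → P X → P Y) ∧
  (∀ X Y : A, P X → P Y → P (X ⊞ Y))

/-- `P` is closed under extensions. -/
def ClosedUnderExtensions (P : A → Prop) : Prop :=
  ∀ S : CategoryTheory.ShortComplex A, S.ShortExact → P S.X₁ → P S.X₃ → P S.X₂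

/-- `P` is closed under subobjects. -/
def ClosedUnderSubobjects (P : A → Prop) : Prop :=
  ∀ (X Y : A) (f : X ⟶ Y), Mono f → P Y → P X

/-- `P` is closed under kernels of morphisms between its objects. -/
def ClosedUnderKernels (P : A → Prop) : Prop :=
  ∀ (X Y : A) (f : X ⟶ Y), P X → P Y → P (kernel f)

/-- A torsion-free class of `A`: an additive subcategory closed under
subobjects and extensions. -/
def IsTorsionFreeClass (P : A → Prop) : Prop :=
  IsAdditiveSubcat P ∧ ClosedUnderSubobjects P ∧ ClosedUnderExtensions P

/-- A KE-closed subcategory of `A`: an additive subcategory closed under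
kernels and extensions. -/
def IsKEClosed (P : A → Prop) : Prop :=
  IsAdditiveSubcat P ∧ ClosedUnderKernels P ∧ ClosedUnderExtensions P

/-- `S` is a torsion-free class of the extension-closed subcategory `C`
(in the sense of exact categories): `S ⊆ C`, `S` is an additive subcategory,
and for any conflation `0 → X₁ → X₂ → X₃ → 0` of `C`, `S` is closed under
the conflation and under admissible subobjects. -/
def IsTorsionFreeClassOf (C S : A → Prop) : Prop :=
  (∀ X, S X → C X) ∧ IsAdditiveSubcat S ∧
  (∀ T : CategoryTheory.ShortComplex A, T.ShortExact → C T.X₁ → C T.X₂ → C T.X₃ →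
    (S T.X₁ → S T.X₃ → S T.X₂)) ∧
  (∀ T : CategoryTheory.ShortComplex A, T.ShortExact → C T.X₁ → C T.X₂ → C T.X₃ →
    (S T.X₂ → S T.X₁))

/-- The torsion-free closure `F(X)`: the smallest torsion-free class of `A`
containing `X`, realized as the intersection of all torsion-free classes
containing `X`. -/
def torsionFreeClosure (P : A → Prop) : A → Prop :=
  fun M => ∀ F : A → Prop, IsTorsionFreeClass F → (∀ N, P N → F N) → F M

/-- The objects `N` such that every morphism from an object of `P` to `N` has its kernel in `P`. -/
def HasKernelsIn (P : A → Prop) (N : A) : Prop :=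
  ∀ (M : A) (f : M ⟶ N), P M → P (kernel f)

/-- The kernel of a morphism `f` to the middle term of a short exact sequence is the kernel of the
morphism from `kernel (f ≫ T.g)` to the left term induced by `f`. -/
noncomputable def kernelIsoKernelLift {T : ShortComplex A} (hT : T.ShortExact) {M : A}
    (f : M ⟶ T.X₂) (φ : kernel (f ≫ T.g) ⟶ T.X₁) (hφ : φ ≫ T.f = kernel.ι (f ≫ T.g) ≫ f) :
    kernel φ ≅ kernel f where
  hom := kernel.lift f (kernel.ι φ ≫ kernel.ι (f ≫ T.g)) (by
    rw [Category.assoc, ← hφ, kernel.condition_assoc, zero_comp])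
  inv := kernel.lift φ (kernel.lift (f ≫ T.g) (kernel.ι f) (by
    rw [kernel.condition_assoc, zero_comp])) (by
      have := hT.mono_f
      rw [← cancel_mono T.f, Category.assoc, hφ, kernel.lift_ι_assoc, kernel.condition, zero_comp])
  hom_inv_id := by
    rw [← cancel_mono (kernel.ι φ), ← cancel_mono (kernel.ι (f ≫ T.g))]
    simp
  inv_hom_id := by
    rw [← cancel_mono (kernel.ι f)]
    simp

theorem isTorsionFreeClass_of_subobjects_of_extensions {P : A → Prop}
    (hzero : ∀ Z : A, IsZero Z → P Z) (hsub : ClosedUnderSubobjects P)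
    (hext : ClosedUnderExtensions P) : IsTorsionFreeClass P := by
  refine ⟨⟨hzero, fun X Y e hX => hsub Y X e.inv inferInstance hX, fun X Y hX hY => ?_⟩, hsub, hext⟩
  exact hext (ShortComplex.mk (biprod.inl : X ⟶ X ⊞ Y) biprod.snd (by simp))
    (ShortComplex.Splitting.ofHasBinaryBiproduct X Y).shortExact hX hY

theorem isTorsionFreeClass_hasKernelsIn {P : A → Prop}
    (hiso : ∀ X Y : A, (X ≅ Y) → P X → P Y) : IsTorsionFreeClass (HasKernelsIn P) := by
  refine isTorsionFreeClass_of_subobjects_of_extensions ?_ ?_ ?_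
  · intro Z hZ M f hM
    obtain rfl : f = 0 := hZ.eq_of_tgt f 0
    exact hiso _ _ kernelZeroIsoSource.symm hM
  · intro N' N i _ hN M f hM
    exact hiso _ _ (kernelCompMono f i) (hN M (f ≫ i) hM)
  · intro T hT h₁ h₃ M f hM
    have := hT.mono_f
    have hk : (kernel.ι (f ≫ T.g) ≫ f) ≫ T.g = 0 := by
      rw [Category.assoc, kernel.condition]
    exact hiso _ _ (kernelIsoKernelLift hT f (hT.exact.lift _ hk) (hT.exact.lift_f _ hk))
      (h₁ _ _ (h₃ M (f ≫ T.g) hM))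

theorem le_torsionFreeClosure (P : A → Prop) (N : A) (hN : P N) : torsionFreeClosure P N :=
  fun _ _ h => h N hN

theorem isTorsionFreeClass_torsionFreeClosure (P : A → Prop) :
    IsTorsionFreeClass (torsionFreeClosure P) :=
  isTorsionFreeClass_of_subobjects_of_extensions
    (fun Z hZ _ hF _ => hF.1.1 Z hZ)
    (fun X Y f hf hY F hF hP => hF.2.1 X Y f hf (hY F hF hP))
    (fun T hT h₁ h₃ F hF hP => hF.2.2 T hT (h₁ F hF hP) (h₃ F hF hP))

theorem IsKEClosed.isTorsionFreeClassOf_torsionFreeClosure {P : A → Prop} (hP : IsKEClosed P) :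
    IsTorsionFreeClassOf (torsionFreeClosure P) P := by
  refine ⟨le_torsionFreeClosure P, hP.1, fun T hT _ _ _ => hP.2.2 T hT, fun T hT _ _ h₃ h => ?_⟩
  have hker : HasKernelsIn P T.X₃ :=
    h₃ _ (isTorsionFreeClass_hasKernelsIn hP.1.2.1) fun N hN M f hM => hP.2.1 M N f hM hN
  exact hP.1.2.1 _ _ ((kernelIsKernel T.g).conePointUniqueUpToIso hT.fIsKernel)
    (hker T.X₂ T.g h)

theorem IsTorsionFreeClassOf.isKEClosed {F P : A → Prop} (hF : IsTorsionFreeClass F)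
    (hP : IsTorsionFreeClassOf F P) : IsKEClosed P := by
  obtain ⟨hle, hadd, hext, hsub⟩ := hP
  refine ⟨hadd, fun M N f hM hN => ?_, fun T hT h₁ h₃ =>
    hext T hT (hle _ h₁) (hF.2.2 T hT (hle _ h₁) (hle _ h₃)) (hle _ h₃) h₁ h₃⟩
  let T : ShortComplex A := ShortComplex.mk (kernel.ι f) (Abelian.factorThruImage f)
    (by rw [← cancel_mono (Abelian.image.ι f)]; simp)
  have hT : T.ShortExact :=
    { exact := T.exact_of_f_is_kernel <|
        isKernelOfComp (Abelian.image.ι f) f (kernelIsKernel f) T.zero (Abelian.image.fac f)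
      mono_f := inferInstanceAs (Mono (kernel.ι f))
      epi_g := inferInstanceAs (Epi (Abelian.factorThruImage f)) }
  exact hsub T hT (hF.2.1 _ _ (kernel.ι f) inferInstance (hle _ hM)) (hle _ hM)
    (hF.2.1 _ _ (Abelian.image.ι f) inferInstance (hle _ hN)) hM

theorem KE_closed_tfae (X : A → Prop) :
    List.TFAE
      [ IsKEClosed X,
        IsTorsionFreeClassOf (torsionFreeClosure X) X,
        ∃ F : A → Prop, IsTorsionFreeClass F ∧ IsTorsionFreeClassOf F X ] := by
  tfae_have 1 → 2 := IsKEClosed.isTorsionFreeClassOf_torsionFreeClosure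
  tfae_have 2 → 3 := fun h => ⟨_, isTorsionFreeClass_torsionFreeClosure X, h⟩
  tfae_have 3 → 1 := fun ⟨_, hF, hX⟩ => hX.isKEClosed hF
  tfae_finish
end

section
/- Let A be an abelian category and X a subcategory of A. The following are equivalent: (i) X is a CE-closed subcategory of A; (ii) X is a torsion class of the torsion closure T(X) (in the sense of extension-closed subcategories); (iii) there exists a torsion class T of A such that X is a torsion class of T. -/
/-!
Statement 1: For a subcategory `X` of an abelian category `A`, TFAE:
(i) `X` is a CE-closed subcategory of `A`;
(ii) `X` is a torsion class of its torsion closure `T(X)`;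
(iii) there is a torsion class `T` of `A` such that `X` is a torsion class of `T`.
-/

open CategoryTheory CategoryTheory.Limits

universe v u

variable {A : Type u} [Category.{v} A] [Abelian A]

/-- `P` is closed under quotient objects. -/
def ClosedUnderQuotients (P : A → Prop) : Prop :=
  ∀ (X Y : A) (f : X ⟶ Y), Epi f → P X → P Y

/-- `P` is closed under cokernels of morphisms between its objects. -/
def ClosedUnderCokernels (P : A → Prop) : Prop :=
  ∀ (X Y : A) (f : X ⟶ Y), P X → P Y → P (cokernel f)

/-- A torsion class of `A`: an additive subcategory closed under
quotients and extensions. -/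
def IsTorsionClass (P : A → Prop) : Prop :=
  IsAdditiveSubcat P ∧ ClosedUnderQuotients P ∧ ClosedUnderExtensions P

/-- A CE-closed subcategory of `A`: an additive subcategory closed under
cokernels and extensions. -/
def IsCEClosed (P : A → Prop) : Prop :=
  IsAdditiveSubcat P ∧ ClosedUnderCokernels P ∧ ClosedUnderExtensions P

/-- `S` is a torsion class of the extension-closed subcategory `C`
(in the sense of exact categories): `S ⊆ C`, `S` is an additive subcategory,
and for any conflation `0 → X₁ → X₂ → X₃ → 0` of `C`, `S` is closed under
the conflation and under admissible quotients. -/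
def IsTorsionClassOf (C S : A → Prop) : Prop :=
  (∀ X, S X → C X) ∧ IsAdditiveSubcat S ∧
  (∀ T : CategoryTheory.ShortComplex A, T.ShortExact → C T.X₁ → C T.X₂ → C T.X₃ →
    (S T.X₁ → S T.X₃ → S T.X₂)) ∧
  (∀ T : CategoryTheory.ShortComplex A, T.ShortExact → C T.X₁ → C T.X₂ → C T.X₃ →
    (S T.X₂ → S T.X₃))

/-- The torsion closure `T(X)`: the smallest torsion class of `A`
containing `X`, realized as the intersection of all torsion classes
containing `X`. -/
def torsionClosure (P : A → Prop) : A → Prop :=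
  fun M => ∀ T : A → Prop, IsTorsionClass T → (∀ N, P N → T N) → T M

/-- Closure under quotients implies closure under isomorphisms, and closure under extensions
implies closure under binary biproducts. -/
theorem isTorsionClass_of_quotients_of_extensions {P : A → Prop} (h0 : ∀ Z : A, IsZero Z → P Z)
    (hq : ClosedUnderQuotients P) (he : ClosedUnderExtensions P) : IsTorsionClass P :=
  ⟨⟨h0, fun X Y e => hq X Y e.hom inferInstance, fun X Y =>
    he _ (ShortComplex.Splitting.ofHasBinaryBiproduct X Y).shortExact⟩, hq, he⟩

theorem subset_torsionClosure (P : A → Prop) (M : A) (h : P M) : torsionClosure P M :=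
  fun _ _ hT => hT M h

theorem isTorsionClass_torsionClosure (P : A → Prop) : IsTorsionClass (torsionClosure P) :=
  isTorsionClass_of_quotients_of_extensions
    (fun Z hZ _ hT _ => hT.1.1 Z hZ)
    (fun M N f hf hM T hT hP => hT.2.1 M N f hf (hM T hT hP))
    (fun S hS h₁ h₃ T hT hP => hT.2.2 S hS (h₁ T hT hP) (h₃ T hT hP))

/-- The cokernel of a morphism out of an extension, computed by first dividing out the
subobject and then the quotient of the extension. -/
theorem exists_cokernel_iso_of_shortExact {S : ShortComplex A} (hS : S.ShortExact) {M : A}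
    (f : S.X₂ ⟶ M) :
    ∃ h : S.X₃ ⟶ cokernel (S.f ≫ f), Nonempty (cokernel h ≅ cokernel f) := by
  have := hS.epi_g
  have hw : S.f ≫ f ≫ cokernel.π (S.f ≫ f) = 0 := by
    rw [← Category.assoc, cokernel.condition]
  let h : S.X₃ ⟶ cokernel (S.f ≫ f) := hS.exact.desc (f ≫ cokernel.π (S.f ≫ f)) hw
  have hh : S.g ≫ h = f ≫ cokernel.π (S.f ≫ f) := hS.exact.g_desc _ hw
  have h₁ : (S.f ≫ f) ≫ cokernel.π f = 0 := by simp
  have h₂ : h ≫ cokernel.desc (S.f ≫ f) (cokernel.π f) h₁ = 0 := by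
    rw [← cancel_epi S.g, reassoc_of% hh]
    simp
  have h₃ : f ≫ cokernel.π (S.f ≫ f) ≫ cokernel.π h = 0 := by
    rw [← reassoc_of% hh, cokernel.condition, comp_zero]
  refine ⟨h, ⟨⟨cokernel.desc h _ h₂, cokernel.desc f _ h₃, ?_, ?_⟩⟩⟩
  · rw [← cancel_epi (cokernel.π h), ← cancel_epi (cokernel.π (S.f ≫ f))]
    simp
  · rw [← cancel_epi (cokernel.π f)]
    simp

/-- The objects all of whose morphisms to objects of an isomorphism-closed `X` have cokernel
in `X` form a torsion class. -/
theorem isTorsionClass_cokernel_mem {X : A → Prop} (hX : ∀ M N : A, (M ≅ N) → X M → X N) :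
    IsTorsionClass fun L : A => ∀ (M : A) (f : L ⟶ M), X M → X (cokernel f) := by
  refine isTorsionClass_of_quotients_of_extensions ?_ ?_ ?_
  · intro Z hZ M f hM
    obtain rfl := hZ.eq_of_src f 0
    exact hX _ _ cokernelZeroIsoTarget.symm hM
  · intro L L' p hp hL M f hM
    exact hX _ _ (cokernelEpiComp p f) (hL M (p ≫ f) hM)
  · intro S hS h₁ h₃ M f hM
    obtain ⟨h, ⟨e⟩⟩ := exists_cokernel_iso_of_shortExact hS f
    exact hX _ _ e (h₃ _ h (h₁ M (S.f ≫ f) hM))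

theorem IsCEClosed.isTorsionClassOf_torsionClosure {X : A → Prop} (hX : IsCEClosed X) :
    IsTorsionClassOf (torsionClosure X) X := by
  obtain ⟨hadd, hcok, hext⟩ := hX
  refine ⟨subset_torsionClosure X, hadd, fun S hS _ _ _ => hext S hS, ?_⟩
  intro S hS hS₁ _ _ hS₂
  exact hadd.2.1 _ _ ((cokernelIsCokernel S.f).coconePointUniqueUpToIso hS.gIsCokernel)
    (hS₁ _ (isTorsionClass_cokernel_mem hadd.2.1) (fun N hN M f => hcok N M f hN) _ S.f hS₂)

theorem IsTorsionClassOf.isCEClosed {T X : A → Prop} (hT : IsTorsionClass T)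
    (hX : IsTorsionClassOf T X) : IsCEClosed X := by
  obtain ⟨_, hquot, hext⟩ := hT
  obtain ⟨hXT, hadd, hconf, hadm⟩ := hX
  refine ⟨hadd, ?_, ?_⟩
  · intro M N f hM hN
    let S : ShortComplex A := ShortComplex.mk (Abelian.image.ι f) (cokernel.π f)
      (kernel.condition _)
    have hS : S.ShortExact :=
      { exact := S.exact_of_f_is_kernel (kernelIsKernel (cokernel.π f))
        mono_f := inferInstanceAs (Mono (Abelian.image.ι f))
        epi_g := inferInstanceAs (Epi (cokernel.π f)) }
    exact hadm S hS
      (hquot M _ (Abelian.factorThruImage f) inferInstance (hXT M hM)) (hXT N hN)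
      (hquot N _ (cokernel.π f) inferInstance (hXT N hN)) hN
  · intro S hS h₁ h₃
    exact hconf S hS (hXT _ h₁) (hext S hS (hXT _ h₁) (hXT _ h₃)) (hXT _ h₃) h₁ h₃

theorem CE_closed_tfae (X : A → Prop) :
    List.TFAE
      [ IsCEClosed X,
        IsTorsionClassOf (torsionClosure X) X,
        ∃ T : A → Prop, IsTorsionClass T ∧ IsTorsionClassOf T X ] := by
  tfae_have 1 → 2 := IsCEClosed.isTorsionClassOf_torsionClosure
  tfae_have 2 → 3 := fun h => ⟨_, isTorsionClass_torsionClosure X, h⟩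
  tfae_have 3 → 1 := fun ⟨_, hT, h⟩ => h.isCEClosed hT
  tfae_finish
end

section
/- Let A be an abelian category in which Serre subcategories and torsion classes coincide. Then every CE-closed subcategory of A is a Serre subcategory of A (equivalently, Serre subcategories, torsion classes, wide subcategories, ICE-closed subcategories and CE-closed subcategories all coincide in A). -/
/-!
Statement 5: Let `A` be an abelian category in which Serre subcategories and
torsion classes coincide (i.e. every torsion class of `A` is a Serre
subcategory of `A`). Then every CE-closed subcategory of `A` is a Serre
subcategory of `A`.
-/

open CategoryTheory CategoryTheory.Limits

universe v u

variable {A : Type u} [Category.{v} A] [Abelian A]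

/-- A Serre subcategory of `A`. -/
def IsSerreSubcat (P : A → Prop) : Prop :=
  IsAdditiveSubcat P ∧ ClosedUnderSubobjects P ∧ ClosedUnderQuotients P ∧
    ClosedUnderExtensions P

/-- The objects `K` such that the cokernel of every morphism from `K` to an object of `P`
lies in `P`. -/
def HasCokernelsInto (P : A → Prop) (K : A) : Prop :=
  ∀ (M : A) (g : K ⟶ M), P M → P (cokernel g)

/-- Dividing out the image of `f ≫ g` does not change the cokernel of `g`. -/
noncomputable def cokernelCompCokernelπIso {K L M : A} (f : K ⟶ L) (g : L ⟶ M) :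
    cokernel (g ≫ cokernel.π (f ≫ g)) ≅ cokernel g where
  hom := cokernel.desc _ (cokernel.desc _ (cokernel.π g) (by simp)) (by simp)
  inv := cokernel.desc _ (cokernel.π (f ≫ g) ≫ cokernel.π (g ≫ cokernel.π (f ≫ g)))
    (by rw [← Category.assoc, cokernel.condition])

theorem closedUnderQuotients_hasCokernelsInto {P : A → Prop} (hP : IsAdditiveSubcat P) :
    ClosedUnderQuotients (HasCokernelsInto P) := fun _ _ f _ hK M g hM =>
  hP.2.1 _ _ (cokernelEpiComp f g) (hK M (f ≫ g) hM)

theorem closedUnderExtensions_hasCokernelsInto {P : A → Prop} (hP : IsAdditiveSubcat P) :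
    ClosedUnderExtensions (HasCokernelsInto P) := by
  intro S hS h₁ h₃ M g hM
  have := hS.epi_g
  have w : S.f ≫ g ≫ cokernel.π (S.f ≫ g) = 0 := by
    rw [← Category.assoc, cokernel.condition]
  have h := h₃ _ (hS.exact.desc _ w) (h₁ M (S.f ≫ g) hM)
  have e := (cokernelEpiComp S.g (hS.exact.desc _ w)).symm ≪≫
    cokernelIsoOfEq (hS.exact.g_desc _ w) ≪≫ cokernelCompCokernelπIso S.f g
  exact hP.2.1 _ _ e h

theorem isTorsionClass_hasCokernelsInto {P : A → Prop} (hP : IsAdditiveSubcat P) :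
    IsTorsionClass (HasCokernelsInto P) := by
  refine ⟨⟨fun Z hZ M g hM => ?_, fun K L e hK => ?_, fun K L hK hL => ?_⟩,
    closedUnderQuotients_hasCokernelsInto hP, closedUnderExtensions_hasCokernelsInto hP⟩
  · obtain rfl : g = 0 := hZ.eq_of_src _ _
    exact hP.2.1 _ _ cokernelZeroIsoTarget.symm hM
  · exact closedUnderQuotients_hasCokernelsInto hP K L e.hom inferInstance hK
  · exact closedUnderExtensions_hasCokernelsInto hP _
      (ShortComplex.Splitting.ofHasBinaryBiproduct K L).shortExact hK hL

theorem CE_closed_eq_serre_of_torsion_eq_serre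
    (h : ∀ T : A → Prop, IsTorsionClass T → IsSerreSubcat T) :
    ∀ X : A → Prop, IsCEClosed X → IsSerreSubcat X := by
  intro X hX
  refine h X ⟨hX.1, fun M Y f _ hM => ?_, hX.2.2⟩
  have hK : HasCokernelsInto X (kernel f) :=
    (h _ (isTorsionClass_hasCokernelsInto hX.1)).2.1 _ _ (kernel.ι f) inferInstance
      fun N g hN => hX.2.1 M N g hM hN
  exact hX.1.2.1 _ _
    ((cokernelIsCokernel (kernel.ι f)).coconePointUniqueUpToIso
      (Abelian.epiIsCokernelOfKernel _ (limit.isLimit _)))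
    (hK M (kernel.ι f) hM)
end

section
/- Let A be an abelian category in which Serre subcategories and torsion classes coincide, and let X be a torsion-free class of A. Then every torsion class of X (in the sense of extension-closed subcategories) is a Serre subcategory of X; that is, torsion classes and Serre subcategories of X coincide. -/
/-!
Statement 6: Let `A` be an abelian category in which Serre subcategories and
torsion classes coincide (i.e. every torsion class of `A` is Serre), and let
`X` be a torsion-free class of `A`. Then torsion classes and Serre
subcategories of `X` (in the sense of extension-closed subcategories)
coincide.
-/

open CategoryTheory CategoryTheory.Limits

universe v u

variable {A : Type u} [Category.{v} A] [Abelian A]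

/-- `S` is a Serre subcategory of the extension-closed subcategory `C`. -/
def IsSerreSubcatOf (C S : A → Prop) : Prop :=
  (∀ X, S X → C X) ∧ IsAdditiveSubcat S ∧
  (∀ T : CategoryTheory.ShortComplex A, T.ShortExact → C T.X₁ → C T.X₂ → C T.X₃ →
    (S T.X₁ → S T.X₃ → S T.X₂)) ∧
  (∀ T : CategoryTheory.ShortComplex A, T.ShortExact → C T.X₁ → C T.X₂ → C T.X₃ →
    (S T.X₂ → S T.X₁ ∧ S T.X₃))

/-- The objects `B` such that every object of `X` which is an extension of a quotient of `B` by
an object of `S` belongs to `S`. -/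
def ExtensionsStayIn (X S : A → Prop) (B : A) : Prop :=
  ∀ T : ShortComplex A, T.ShortExact → S T.X₁ → X T.X₂ →
    ∀ p : B ⟶ T.X₃, Epi p → S T.X₂

lemma shortExact_kernel {E Q : A} (q : E ⟶ Q) [Epi q] :
    (ShortComplex.mk (kernel.ι q) q (kernel.condition q)).ShortExact :=
  { exact := ShortComplex.exact_of_f_is_kernel _ (kernelIsKernel q)
    mono_f := inferInstanceAs (Mono (kernel.ι q))
    epi_g := inferInstanceAs (Epi q) }

/-- The base change of a short exact sequence along a morphism to its last term. -/
lemma shortExact_pullback {T : ShortComplex A} (hT : T.ShortExact) {B : A} (p : B ⟶ T.X₃) :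
    (ShortComplex.mk (pullback.lift T.f (0 : T.X₁ ⟶ B) (by simp))
      (pullback.snd T.g p) (pullback.lift_snd _ _ _)).ShortExact := by
  have := hT.mono_f
  have := hT.epi_g
  have hm : Mono (pullback.lift T.f (0 : T.X₁ ⟶ B) (by simp) : T.X₁ ⟶ pullback T.g p) :=
    mono_of_mono_fac (pullback.lift_fst _ _ _)
  refine { exact := ?_, mono_f := hm, epi_g := inferInstanceAs (Epi (pullback.snd T.g p)) }
  rw [ShortComplex.exact_iff_exact_up_to_refinements]
  intro W x hx
  dsimp at x hx
  have hx' : (x ≫ pullback.fst T.g p) ≫ T.g = 0 := by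
    rw [Category.assoc, pullback.condition, reassoc_of% hx, zero_comp]
  refine ⟨W, 𝟙 W, inferInstance, hT.exact.lift _ hx', ?_⟩
  dsimp
  apply pullback.hom_ext
  · rw [Category.assoc, Category.assoc, pullback.lift_fst, hT.exact.lift_f, Category.id_comp]
  · rw [Category.assoc, Category.assoc, pullback.lift_snd, comp_zero, Category.id_comp, hx]

variable {X S : A → Prop}

lemma ExtensionsStayIn.of_epi {B C : A} (hB : ExtensionsStayIn X S B) (f : B ⟶ C) [Epi f] :
    ExtensionsStayIn X S C :=
  fun T hT h₁ h₂ p _ => hB T hT h₁ h₂ (f ≫ p) (epi_comp f p)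

lemma ExtensionsStayIn.of_isZero (hS : IsAdditiveSubcat S) {Z : A} (hZ : IsZero Z) :
    ExtensionsStayIn X S Z := by
  intro T hT h₁ _ p _
  have := hT.isIso_f_iff.2 (hZ.of_epi p)
  exact hS.2.1 _ _ (asIso T.f) h₁

lemma ExtensionsStayIn.of_shortExact (hX : ClosedUnderSubobjects X) {B : ShortComplex A}
    (hB : B.ShortExact) (h₁ : ExtensionsStayIn X S B.X₁) (h₃ : ExtensionsStayIn X S B.X₃) :
    ExtensionsStayIn X S B.X₂ := by
  intro T hT hS₁ hX₂ p _
  have := hT.mono_f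
  have := hT.epi_g
  have := hB.epi_g
  let c := cokernel.π (B.f ≫ p)
  have hc : B.f ≫ p ≫ c = 0 := by rw [← Category.assoc]; exact cokernel.condition _
  let d : B.X₃ ⟶ cokernel (B.f ≫ p) := hB.exact.desc (p ≫ c) hc
  have hd : B.g ≫ d = p ≫ c := hB.exact.g_desc _ _
  have : Epi d := epi_of_epi_fac hd
  -- The preimage in `T.X₂` of the image of `B.X₁` is the base change of `T` along `kernel.ι c`.
  have hP := shortExact_pullback hT (kernel.ι c)
  have hXE : X (pullback T.g (kernel.ι c)) :=
    hX _ _ (pullback.fst T.g (kernel.ι c)) inferInstance hX₂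
  have hSE : S (pullback T.g (kernel.ι c)) :=
    h₁ _ hP hS₁ hXE (Abelian.factorThruImage (B.f ≫ p))
      (inferInstanceAs (Epi (Abelian.factorThruImage (B.f ≫ p))))
  have w : pullback.fst T.g (kernel.ι c) ≫ T.g ≫ c = 0 := by
    rw [pullback.condition_assoc, kernel.condition, comp_zero]
  refine h₃ (ShortComplex.mk _ _ w) { exact := ?_, mono_f := ?_, epi_g := ?_ } hSE hX₂ d
    inferInstance
  · rw [ShortComplex.exact_iff_exact_up_to_refinements]
    intro W x hx
    dsimp at x hx
    exact ⟨W, 𝟙 W, inferInstance,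
      pullback.lift x (kernel.lift c (x ≫ T.g) (by simpa using hx)) (by simp),
      by rw [Category.id_comp]; exact (pullback.lift_fst _ _ _).symm⟩
  · exact inferInstanceAs (Mono (pullback.fst T.g (kernel.ι c)))
  · exact inferInstanceAs (Epi (T.g ≫ c))

lemma isTorsionClass_extensionsStayIn (hX : ClosedUnderSubobjects X)
    (hS : IsAdditiveSubcat S) : IsTorsionClass (ExtensionsStayIn X S) := by
  have hext : ClosedUnderExtensions (ExtensionsStayIn X S) :=
    fun _ hB h₁ h₃ => .of_shortExact hX hB h₁ h₃
  refine ⟨⟨fun Z hZ => .of_isZero hS hZ, fun _ _ e h => h.of_epi e.hom, fun B C hB hC => ?_⟩,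
    fun _ _ f _ h => h.of_epi f, hext⟩
  exact hext (ShortComplex.mk (biprod.inl : B ⟶ B ⊞ C) biprod.snd (by simp))
    (ShortComplex.Splitting.mk biprod.fst biprod.inr).shortExact hB hC

/-- A torsion class of a torsion-free class `X` is closed under extensions by quotients of its
objects, as long as these extensions remain in `X`. -/
lemma IsTorsionClassOf.extensionsStayIn (hX : IsTorsionFreeClass X) (hS : IsTorsionClassOf X S)
    {B : A} (hB : S B) : ExtensionsStayIn X S B := by
  intro T hT hS₁ hX₂ p _
  obtain ⟨hSX, _, hSext, hSquot⟩ := hS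
  obtain ⟨_, hXsub, hXext⟩ := hX
  have hP := shortExact_pullback hT p
  have hXE : X (pullback T.g p) := hXext _ hP (hSX _ hS₁) (hSX _ hB)
  have hSE : S (pullback T.g p) := hSext _ hP (hSX _ hS₁) hXE (hSX _ hB) hS₁ hB
  have := hT.epi_g
  exact hSquot _ (shortExact_kernel (pullback.fst T.g p))
    (hXsub _ _ (kernel.ι (pullback.fst T.g p)) inferInstance hXE) hXE hX₂ hSE

open scoped ZeroObject in
lemma ExtensionsStayIn.mem (hS : IsAdditiveSubcat S) {B : A} (hB : ExtensionsStayIn X S B)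
    (hXB : X B) : S B :=
  hB (ShortComplex.mk (0 : (0 : A) ⟶ B) (𝟙 B) (by simp))
    (ShortComplex.Splitting.mk 0 (𝟙 B)).shortExact (hS.1 _ (isZero_zero A)) hXB (𝟙 B)
    inferInstance

theorem torsion_eq_serre_in_torsionFree
    (h : ∀ T : A → Prop, IsTorsionClass T → IsSerreSubcat T)
    (X : A → Prop) (hX : IsTorsionFreeClass X) :
    ∀ S : A → Prop, IsTorsionClassOf X S ↔ IsSerreSubcatOf X S := by
  intro S
  refine ⟨fun hS => ⟨hS.1, hS.2.1, hS.2.2.1, fun T hT h₁ h₂ h₃ hM => ⟨?_, ?_⟩⟩,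
    fun hS => ⟨hS.1, hS.2.1, hS.2.2.1, fun T hT h₁ h₂ h₃ hM => (hS.2.2.2 T hT h₁ h₂ h₃ hM).2⟩⟩
  · have hSerre := h _ (isTorsionClass_extensionsStayIn hX.2.1 hS.2.1)
    exact (hSerre.2.1 _ _ T.f hT.mono_f (hS.extensionsStayIn hX hM)).mem hS.2.1 h₁
  · exact hS.2.2.2 T hT h₁ h₂ h₃ hM
end

section
/- Let R be a commutative noetherian ring with Krull dimension dim R ≤ 1. Then every KE-closed subcategory of mod R is a torsion-free class of mod R; that is, KE-closed subcategories and torsion-free classes coincide in mod R. -/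
/-! Statement 7: If `R` is a commutative noetherian ring with `dim R ≤ 1`,
then KE-closed subcategories and torsion-free classes coincide in `mod R`. -/

open CategoryTheory

universe u

section Defs

variable (R : Type u) [CommRing R]

/-- `P` is a class of finitely generated `R`-modules (a subcategory of
`mod R`). -/
def IsSubcatOfFGMod (P : ModuleCat.{u} R → Prop) : Prop :=
  ∀ M : ModuleCat.{u} R, P M → Module.Finite R M

/-- `P` is an additive subcategory: it contains the zero modules and is
closed under isomorphisms and finite direct sums. -/
def MIsAdditive (P : ModuleCat.{u} R → Prop) : Prop :=
  (∀ M : ModuleCat.{u} R, Subsingleton M → P M) ∧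
  (∀ M N : ModuleCat.{u} R, (M ≃ₗ[R] N) → P M → P N) ∧
  (∀ M N : ModuleCat.{u} R, P M → P N → P (ModuleCat.of R (M × N)))

/-- `P` is closed under submodules. -/
def MClosedUnderSubmodules (P : ModuleCat.{u} R → Prop) : Prop :=
  ∀ (M : ModuleCat.{u} R) (N : Submodule R M), P M → P (ModuleCat.of R N)

/-- `P` is closed under kernels of `R`-linear maps between its members. -/
def MClosedUnderKernels (P : ModuleCat.{u} R → Prop) : Prop :=
  ∀ (M N : ModuleCat.{u} R) (f : M →ₗ[R] N), P M → P N →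
    P (ModuleCat.of R (LinearMap.ker f))

/-- `P` is closed under extensions: for every short exact sequence
`0 → N → M → M/N → 0`, if the two outer terms lie in `P` then so does `M`.
(Together with closure under isomorphisms this is equivalent to the usual
formulation with arbitrary short exact sequences.) -/
def MClosedUnderExtensions (P : ModuleCat.{u} R → Prop) : Prop :=
  ∀ (M : ModuleCat.{u} R) (N : Submodule R M),
    P (ModuleCat.of R N) → P (ModuleCat.of R (M ⧸ N)) → P M

/-- `P` is a torsion-free class of `mod R`: an additive subcategory of
finitely generated modules closed under submodules and extensions. -/
def MIsTorsionFreeClass (P : ModuleCat.{u} R → Prop) : Prop :=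
  IsSubcatOfFGMod R P ∧ MIsAdditive R P ∧ MClosedUnderSubmodules R P ∧
    MClosedUnderExtensions R P

/-- `P` is a KE-closed subcategory of `mod R`: an additive subcategory of
finitely generated modules closed under kernels and extensions. -/
def MIsKEClosed (P : ModuleCat.{u} R → Prop) : Prop :=
  IsSubcatOfFGMod R P ∧ MIsAdditive R P ∧ MClosedUnderKernels R P ∧
    MClosedUnderExtensions R P

/-- `Ass X`: the union of the associated primes of members of `X`. -/
def AssOf (P : ModuleCat.{u} R → Prop) : Set (Ideal R) :=
  {p | ∃ M : ModuleCat.{u} R, P M ∧ p ∈ associatedPrimes R M}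

/-- `mod^ass_Φ R`: the finitely generated modules all of whose associated
primes lie in `Φ`. -/
def modAss (Φ : Set (Ideal R)) : ModuleCat.{u} R → Prop :=
  fun M => Module.Finite R M ∧ associatedPrimes R M ⊆ Φ

end Defs

section KEClosed

variable {R : Type u} [CommRing R] {P : ModuleCat.{u} R → Prop}

/-- Membership in an additive subcategory is invariant under linear equivalence. -/
theorem MIsAdditive.of_equiv (hP : MIsAdditive R P) {M N : Type u} [AddCommGroup M]
    [AddCommGroup N] [Module R M] [Module R N] (e : M ≃ₗ[R] N) (hM : P (ModuleCat.of R M)) :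
    P (ModuleCat.of R N) :=
  hP.2.1 (ModuleCat.of R M) (ModuleCat.of R N) e hM

/-- Torsion-free classes are closed under kernels. -/
theorem MIsTorsionFreeClass.isKEClosed (hP : MIsTorsionFreeClass R P) : MIsKEClosed R P :=
  ⟨hP.1, hP.2.1, fun M _ f hM _ => hP.2.2.1 M (LinearMap.ker f) hM, hP.2.2.2⟩

/-- A prime `p` for which `R ⧸ p` is a quotient of `M` contains the annihilator of `M`. -/
theorem Module.annihilator_le_of_surjective_quotient {M : Type*} [AddCommGroup M]
    [Module R M] {p : Ideal R} {g : M →ₗ[R] R ⧸ p} (hg : Function.Surjective g) :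
    Module.annihilator R M ≤ p :=
  (g.annihilator_le_of_surjective hg).trans_eq Ideal.annihilator_quotient

/-- In dimension at most one, let `R ⧸ p` be a quotient of `M` with `p ∉ Ass M`. Then `p` contains
an `M`-regular element `x` such that `p ∈ Ass (M / xM)`. -/
theorem exists_isSMulRegular_mem_associatedPrimes_quotient [IsNoetherianRing R]
    (hdim : ringKrullDim R ≤ 1) {M : Type*} [AddCommGroup M] [Module R M] [Module.Finite R M]
    {p : Ideal R} [p.IsPrime] {g : M →ₗ[R] R ⧸ p} (hg : Function.Surjective g)
    (hp : p ∉ associatedPrimes R M) :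
    ∃ x ∈ p, IsSMulRegular M x ∧
      p ∈ associatedPrimes R (M ⧸ LinearMap.range (LinearMap.lsmul R M x)) := by
  have hprime : p.IsPrime := inferInstance
  have hdim' := Ring.krullDimLE_one_iff.1 ((Ring.krullDimLE_iff (n := 1)).2 hdim)
  have mem_ass {q : Ideal R} (hq : q ∈ minimalPrimes R) (hle : Module.annihilator R M ≤ q) :
      q ∈ associatedPrimes R M :=
    Module.associatedPrimes.minimalPrimes_annihilator_subset_associatedPrimes R M
      ⟨⟨hq.1.1, hle⟩, fun r hr hrq => hq.2 ⟨hr.1, bot_le⟩ hrq⟩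
  have hpmax : p.IsMaximal := (hdim' p hprime).resolve_left fun h =>
    hp (mem_ass h (Module.annihilator_le_of_surjective_quotient hg))
  obtain ⟨x, hxp, hx⟩ : ∃ x ∈ p, IsSMulRegular M x := by
    by_contra! h
    have hsub : (p : Set R) ⊆ ⋃ q ∈ associatedPrimes R M, (id q : Ideal R) := by
      simp only [id, biUnion_associatedPrimes_eq_compl_regular]
      exact fun y hy => h y hy
    obtain ⟨q, hq, hpq⟩ := (Ideal.subset_union_prime_finite (associatedPrimes.finite R M)
      ⊥ ⊥ fun q hq _ _ => hq.isPrime).1 hsub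
    exact hp (hpmax.eq_of_le hq.isPrime.ne_top hpq ▸ hq)
  refine ⟨x, hxp, hx,
    Module.associatedPrimes.minimalPrimes_annihilator_subset_associatedPrimes R _ ?_⟩
  have hle : LinearMap.range (LinearMap.lsmul R M x) ≤ LinearMap.ker g := by
    rintro _ ⟨m, rfl⟩
    obtain ⟨r, hr⟩ := Ideal.Quotient.mk_surjective (g m)
    simp [← hr, Algebra.smul_def, Ideal.Quotient.eq_zero_iff_mem.2 hxp]
  have hg' : Function.Surjective (Submodule.liftQ _ g hle) := fun y => by
    obtain ⟨m, rfl⟩ := hg y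
    exact ⟨Submodule.Quotient.mk m, rfl⟩
  refine ⟨⟨hprime, Module.annihilator_le_of_surjective_quotient hg'⟩, ?_⟩
  rintro q ⟨hq, hqann⟩ hqp
  by_contra hne
  have hxq : x ∈ q := hqann <| Module.mem_annihilator.2 fun m => by
    obtain ⟨m, rfl⟩ := Submodule.Quotient.mk_surjective _ m
    rw [← Submodule.Quotient.mk_smul, Submodule.Quotient.mk_eq_zero]
    exact ⟨m, rfl⟩
  have hqmin : q ∈ minimalPrimes R := (hdim' q hq).resolve_right fun h =>
    hne (h.eq_of_le hprime.ne_top hqp).ge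
  have hqass : q ∈ associatedPrimes R M := mem_ass hqmin <|
    ((Submodule.mkQ _).annihilator_le_of_surjective (Submodule.mkQ_surjective _)).trans hqann
  have hxmem : x ∈ ⋃ q ∈ associatedPrimes R M, (q : Set R) := Set.mem_biUnion hqass hxq
  rw [biUnion_associatedPrimes_eq_compl_regular] at hxmem
  exact hxmem hx

namespace MIsKEClosed

variable {M : Type u} [AddCommGroup M] [Module R M]

/-- If `x` is regular on `M ∈ P`, the kernel of any map `M → M / xM` lies in `P`: it is also the
kernel of the second projection from the pullback of that map along `M → M / xM`, and this
pullback is an extension of `M` by `xM ≃ M`. -/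
theorem ker_to_quotient_smul (hP : MIsKEClosed R P) {x : R} (hx : IsSMulRegular M x)
    (hM : P (ModuleCat.of R M)) (f : M →ₗ[R] M ⧸ LinearMap.range (LinearMap.lsmul R M x)) :
    P (ModuleCat.of R (LinearMap.ker f)) := by
  let E : Submodule R (M × M) := LinearMap.eqLocus (f ∘ₗ LinearMap.fst R M M)
    (Submodule.mkQ _ ∘ₗ LinearMap.snd R M M)
  have mem_E (a b : M) : (a, b) ∈ E ↔ f a = Submodule.Quotient.mk b := Iff.rfl
  let p₁ : E →ₗ[R] M := LinearMap.fst R M M ∘ₗ E.subtype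
  let p₂ : E →ₗ[R] M := LinearMap.snd R M M ∘ₗ E.subtype
  have hp₁ : Function.Surjective p₁ := fun a => by
    obtain ⟨b, hb⟩ := Submodule.Quotient.mk_surjective _ (f a)
    exact ⟨⟨(a, b), hb.symm⟩, rfl⟩
  let i : M →ₗ[R] LinearMap.ker p₁ :=
    ((LinearMap.inr R M M ∘ₗ LinearMap.lsmul R M x).codRestrict E fun m =>
      (mem_E 0 (x • m)).2 <| (map_zero f).trans
        ((Submodule.Quotient.mk_eq_zero _).2 (LinearMap.mem_range_self _ m)).symm).codRestrict _ fun _ => rfl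
  have hi : Function.Bijective i := by
    refine ⟨fun a b hab => hx ?_, ?_⟩
    · exact congr_arg (fun z : LinearMap.ker p₁ => z.1.1.2) hab
    · rintro ⟨⟨⟨a, b⟩, hE⟩, ha⟩
      obtain rfl : a = 0 := ha
      rw [mem_E, map_zero, eq_comm, Submodule.Quotient.mk_eq_zero] at hE
      obtain ⟨m, rfl⟩ := hE
      exact ⟨m, rfl⟩
  have hE : P (ModuleCat.of R E) :=
    hP.2.2.2 (ModuleCat.of R E) (LinearMap.ker p₁)
      (hP.2.1.of_equiv (LinearEquiv.ofBijective i hi) hM)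
      (hP.2.1.of_equiv (p₁.quotKerEquivOfSurjective hp₁).symm hM)
  let j : LinearMap.ker f →ₗ[R] LinearMap.ker p₂ :=
    ((LinearMap.inl R M M ∘ₗ (LinearMap.ker f).subtype).codRestrict E fun m => by
      simp [E]).codRestrict _ fun _ => rfl
  have hj : Function.Bijective j := by
    refine ⟨fun a b hab => ?_, ?_⟩
    · exact Subtype.ext (congr_arg (fun z : LinearMap.ker p₂ => z.1.1.1) hab)
    · rintro ⟨⟨⟨a, b⟩, hE⟩, hb⟩
      obtain rfl : b = 0 := hb
      exact ⟨⟨a, by simpa [mem_E] using hE⟩, rfl⟩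
  exact hP.2.1.of_equiv (LinearEquiv.ofBijective j hj).symm
    (hP.2.2.1 (ModuleCat.of R E) (ModuleCat.of R M) p₂ hE hM)

/-- In dimension at most one, the kernel of a surjection from a member of `P` onto `R ⧸ p`, with
`p` prime, lies in `P`. -/
theorem ker_of_surjective_quotient_prime [IsNoetherianRing R] (hdim : ringKrullDim R ≤ 1)
    (hP : MIsKEClosed R P) (hM : P (ModuleCat.of R M)) {p : Ideal R} [p.IsPrime]
    {g : M →ₗ[R] R ⧸ p} (hg : Function.Surjective g) :
    P (ModuleCat.of R (LinearMap.ker g)) := by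
  have : Module.Finite R M := hP.1 _ hM
  by_cases hp : p ∈ associatedPrimes R M
  · obtain ⟨-, f, hf⟩ := (isAssociatedPrime_iff_exists_injective_linearMap p M).1 hp
    rw [← LinearMap.ker_comp_of_ker_eq_bot g (LinearMap.ker_eq_bot_of_injective hf)]
    exact hP.2.2.1 (ModuleCat.of R M) (ModuleCat.of R M) (f ∘ₗ g) hM hM
  · obtain ⟨x, -, hx, hpx⟩ := exists_isSMulRegular_mem_associatedPrimes_quotient hdim hg hp
    obtain ⟨-, f, hf⟩ := (isAssociatedPrime_iff_exists_injective_linearMap p _).1 hpx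
    rw [← LinearMap.ker_comp_of_ker_eq_bot g (LinearMap.ker_eq_bot_of_injective hf)]
    exact hP.ker_to_quotient_smul hx hM (f ∘ₗ g)

/-- In dimension at most one, KE-closed subcategories are closed under submodules. -/
theorem closedUnderSubmodules [IsNoetherianRing R] (hdim : ringKrullDim R ≤ 1)
    (hP : MIsKEClosed R P) : MClosedUnderSubmodules R P := by
  intro M N hM
  have : Module.Finite R M := hP.1 _ hM
  induction N using WellFoundedGT.induction with
  | ind N ih =>
    by_cases hN : N = ⊤
    · subst hN
      exact hP.2.1.of_equiv Submodule.topEquiv.symm hM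
    have := Submodule.Quotient.nontrivial_iff.mpr hN
    obtain ⟨p, hp⟩ := associatedPrimes.nonempty R (M ⧸ N)
    obtain ⟨hprime, f, hf⟩ := (isAssociatedPrime_iff_exists_injective_linearMap p _).1 hp
    let N' : Submodule R M := (LinearMap.range f).comap N.mkQ
    have hle : N ≤ N' := fun y hy => by
      simp [N', (Submodule.Quotient.mk_eq_zero N).2 hy]
    have hlt : N < N' := by
      refine lt_of_le_of_ne hle fun h => ?_
      obtain ⟨m, hm⟩ := N.mkQ_surjective (f 1)
      have hmN : m ∈ N := h ▸ (⟨1, hm.symm⟩ : m ∈ N')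
      have h1 : f 1 = 0 := by rw [← hm]; exact (Submodule.Quotient.mk_eq_zero N).2 hmN
      have := Ideal.Quotient.nontrivial_iff.2 hprime.ne_top
      exact one_ne_zero (hf (h1.trans (map_zero f).symm))
    let e := LinearEquiv.ofInjective f hf
    let q : N' →ₗ[R] LinearMap.range f := N.mkQ.restrict fun _ h => h
    have hq : Function.Surjective q := fun ⟨y, hy⟩ => by
      obtain ⟨m, rfl⟩ := N.mkQ_surjective y
      exact ⟨⟨m, hy⟩, rfl⟩
    have hker : LinearMap.ker (e.symm.toLinearMap ∘ₗ q) = N.submoduleOf N' := by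
      ext ⟨m, hm⟩
      simp [q, Submodule.submoduleOf, Subtype.ext_iff]
    have hmem := hP.ker_of_surjective_quotient_prime hdim (ih N' hlt)
      (g := e.symm.toLinearMap ∘ₗ q) (e.symm.surjective.comp hq)
    rw [hker] at hmem
    exact hP.2.1.of_equiv (Submodule.submoduleOfEquivOfLe hle) hmem

end MIsKEClosed

end KEClosed

theorem KE_eq_torsionFree_of_dim_le_one (R : Type u) [CommRing R]
    [IsNoetherianRing R] (hdim : ringKrullDim R ≤ 1) :
    ∀ P : ModuleCat.{u} R → Prop, MIsKEClosed R P ↔ MIsTorsionFreeClass R P := by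
  exact fun P => ⟨fun hP => ⟨hP.1, hP.2.1, hP.closedUnderSubmodules hdim, hP.2.2.2⟩,
    fun hP => hP.isKEClosed⟩
end

section
/- Let R be a commutative noetherian ring such that KE-closed subcategories and torsion-free classes coincide in mod R. Then the Krull dimension of R is at most 2. -/
/-! Statement 8: If `R` is a commutative noetherian ring in which every
KE-closed subcategory of `mod R` is a torsion-free class, then `dim R ≤ 2`. -/

open CategoryTheory

universe u

section RestrictionBijective

variable {R : Type*} [CommRing R] (I : Ideal R)

/-- The canonical map `M → Hom(I, M)` is bijective. Over a noetherian ring and for finitely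
generated `M` this says that `I` has grade at least two on `M`. -/
def RestrictionBijective (M : Type*) [AddCommGroup M] [Module R M] : Prop :=
  (∀ m : M, (∀ r ∈ I, r • m = 0) → m = 0) ∧
    ∀ φ : I →ₗ[R] M, ∃ m : M, ∀ r : I, φ r = (r : R) • m

variable {I} {K M N : Type*} [AddCommGroup K] [Module R K] [AddCommGroup M] [Module R M]
  [AddCommGroup N] [Module R N] {f : K →ₗ[R] M} {g : M →ₗ[R] N}

theorem RestrictionBijective.of_exact_left (hf : Function.Injective f)
    (hfg : Function.Exact f g) (hM : RestrictionBijective I M) (hN : RestrictionBijective I N) :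
    RestrictionBijective I K := by
  refine ⟨fun k hk => hf ?_, fun φ => ?_⟩
  · rw [map_zero]
    exact hM.1 _ fun r hr => by rw [← map_smul, hk r hr, map_zero]
  · obtain ⟨m, hm⟩ := hM.2 (f ∘ₗ φ)
    have hgm : g m = 0 := hN.1 _ fun r hr => by
      rw [← map_smul, ← hm ⟨r, hr⟩]
      exact hfg.apply_apply_eq_zero _
    obtain ⟨k, rfl⟩ := (hfg m).1 hgm
    exact ⟨k, fun r => hf (by rw [map_smul, ← hm r]; rfl)⟩

theorem RestrictionBijective.of_exact_middle (hf : Function.Injective f)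
    (hfg : Function.Exact f g) (hg : Function.Surjective g)
    (hK : RestrictionBijective I K) (hN : RestrictionBijective I N) :
    RestrictionBijective I M := by
  refine ⟨fun m hm => ?_, fun φ => ?_⟩
  · obtain ⟨k, rfl⟩ := (hfg m).1 (hN.1 _ fun r hr => by rw [← map_smul, hm r hr, map_zero])
    rw [hK.1 k fun r hr => hf (by rw [map_smul, hm r hr, map_zero]), map_zero]
  · obtain ⟨n, hn⟩ := hN.2 (g ∘ₗ φ)
    obtain ⟨m, rfl⟩ := hg n
    let ψ : I →ₗ[R] M := φ - (LinearMap.toSpanSingleton R M m) ∘ₗ I.subtype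
    have hψ (r : I) : ψ r = φ r - (r : R) • m := rfl
    have hrange (r : I) : ψ r ∈ LinearMap.range f := by
      refine (hfg _).1 ?_
      rw [hψ, map_sub, map_smul, ← hn r]
      exact sub_self _
    let e := LinearEquiv.ofInjective f hf
    obtain ⟨k, hk⟩ := hK.2 (e.symm.toLinearMap ∘ₗ ψ.codRestrict _ hrange)
    refine ⟨m + f k, fun r => ?_⟩
    have hr : f (e.symm (ψ.codRestrict _ hrange r)) = ψ r :=
      congrArg Subtype.val (e.apply_symm_apply (ψ.codRestrict _ hrange r))
    have hk' : e.symm (ψ.codRestrict _ hrange r) = (r : R) • k := hk r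
    rw [hk', map_smul, hψ] at hr
    rw [smul_add, hr, add_sub_cancel]

theorem RestrictionBijective.of_subsingleton [Subsingleton M] : RestrictionBijective I M :=
  ⟨fun _ _ => Subsingleton.elim _ _, fun _ => ⟨0, fun _ => Subsingleton.elim _ _⟩⟩

end RestrictionBijective

section LocalizedClass

variable {R : Type u} [CommRing R]

/-- The finitely generated modules `M` such that `M_q → Hom(q, M_q)` is bijective; over a
noetherian ring these are the `M` such that `M_q` is zero or of depth at least two. -/
def localDepthTwo (q : Ideal R) [q.IsPrime] (M : ModuleCat.{u} R) : Prop :=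
  Module.Finite R M ∧ RestrictionBijective q (LocalizedModule q.primeCompl M)

theorem localDepthTwo.extension (q : Ideal R) [q.IsPrime] {K M N : ModuleCat.{u} R}
    {f : K →ₗ[R] M} {g : M →ₗ[R] N} (hf : Function.Injective f) (hfg : Function.Exact f g)
    (hg : Function.Surjective g) (hK : localDepthTwo q K) (hN : localDepthTwo q N) :
    localDepthTwo q M := by
  have := hK.1
  have := hN.1
  refine ⟨Module.Finite.of_exact hfg hg, ?_⟩
  let S := q.primeCompl
  let ι (X : ModuleCat.{u} R) := LocalizedModule.mkLinearMap S X
  exact .of_exact_middle (IsLocalizedModule.map_injective S (ι K) (ι M) f hf)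
    (IsLocalizedModule.map_exact S (ι K) (ι M) (ι N) f g hfg)
    (IsLocalizedModule.map_surjective S (ι M) (ι N) g hg) hK.2 hN.2

theorem localDepthTwo.kernel [IsNoetherianRing R] (q : Ideal R) [q.IsPrime]
    {K M N : ModuleCat.{u} R} {f : K →ₗ[R] M} {g : M →ₗ[R] N} (hf : Function.Injective f)
    (hfg : Function.Exact f g) (hM : localDepthTwo q M) (hN : localDepthTwo q N) :
    localDepthTwo q K := by
  have := hM.1
  refine ⟨Module.Finite.of_injective f hf, ?_⟩
  let S := q.primeCompl
  let ι (X : ModuleCat.{u} R) := LocalizedModule.mkLinearMap S X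
  exact .of_exact_left (IsLocalizedModule.map_injective S (ι K) (ι M) f hf)
    (IsLocalizedModule.map_exact S (ι K) (ι M) (ι N) f g hfg) hM.2 hN.2

theorem localDepthTwo_of_subsingleton (q : Ideal R) [q.IsPrime] (M : ModuleCat.{u} R)
    [Subsingleton M] : localDepthTwo q M :=
  ⟨inferInstance, .of_subsingleton⟩

theorem localDepthTwo.mIsKEClosed [IsNoetherianRing R] (q : Ideal R) [q.IsPrime] :
    MIsKEClosed R (localDepthTwo q) := by
  refine ⟨fun M hM => hM.1, ⟨fun M hM => localDepthTwo_of_subsingleton q M, ?_, ?_⟩, ?_, ?_⟩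
  · intro M N e hM
    refine localDepthTwo.kernel q (g := (0 : M →ₗ[R] M)) e.symm.injective ?_ hM hM
    exact fun m => ⟨fun _ => e.symm.surjective m, fun _ => rfl⟩
  · intro M N hM hN
    exact localDepthTwo.extension q (f := LinearMap.inl R M N) (g := LinearMap.snd R M N)
      LinearMap.inl_injective Function.Exact.inl_snd LinearMap.snd_surjective hM hN
  · intro M N f hM hN
    exact localDepthTwo.kernel q (f := (LinearMap.ker f).subtype) (g := f)
      Subtype.val_injective (LinearMap.exact_subtype_ker_map f) hM hN
  · intro M N hN hQ
    exact localDepthTwo.extension q (f := N.subtype) (g := N.mkQ)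
      Subtype.val_injective (LinearMap.exact_subtype_mkQ N) N.mkQ_surjective hN hQ

end LocalizedClass

section PrimeQuotient

variable {R : Type*} [CommRing R]

theorem Ideal.FG.exists_mul_mem_of_forall_exists_mul_mem {q I : Ideal R} (hq : q.FG)
    (S : Submonoid R) (h : ∀ r ∈ q, ∃ t ∈ S, t * r ∈ I) : ∃ t ∈ S, ∀ r ∈ q, t * r ∈ I := by
  obtain ⟨s, rfl⟩ := hq
  have h' (r : s) : ∃ t ∈ S, t * (r : R) ∈ I := h r (Ideal.subset_span r.2)
  choose t htS ht using h'
  refine ⟨∏ r, t r, S.prod_mem fun r _ => htS r, fun r hr => ?_⟩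
  induction hr using Submodule.span_induction with
  | mem r hr =>
    obtain ⟨c, hc⟩ := Finset.dvd_prod_of_mem t (Finset.mem_univ (⟨r, hr⟩ : s))
    rw [hc, mul_right_comm]
    exact I.mul_mem_right _ (ht ⟨r, hr⟩)
  | zero => simp
  | add a b _ _ ha hb => rw [mul_add]; exact I.add_mem ha hb
  | smul c a _ ha => rw [smul_eq_mul, mul_left_comm]; exact I.mul_mem_left _ ha

theorem smul_eq_zero_of_notMem_prime {p q : Ideal R} [p.IsPrime] [q.IsPrime] (hpq : p ≤ q)
    {x : R} (hx : x ∉ p) {z : LocalizedModule q.primeCompl (R ⧸ p)} (hz : x • z = 0) : z = 0 := by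
  induction z using LocalizedModule.induction_on with
  | h m s =>
    obtain ⟨a, rfl⟩ := Ideal.Quotient.mk_surjective m
    rw [LocalizedModule.smul'_mk, ← LocalizedModule.zero_mk s, LocalizedModule.mk_eq] at hz
    obtain ⟨c, hc⟩ := hz
    rw [smul_zero, smul_zero, ← mul_smul] at hc
    suffices a ∈ p by rw [Ideal.Quotient.eq_zero_iff_mem.2 this, LocalizedModule.zero_mk]
    have hmem : (c * s : R) * (x * a) ∈ p := Ideal.Quotient.eq_zero_iff_mem.1 hc
    have hxa := (‹p.IsPrime›.mem_or_mem hmem).resolve_left fun h => (c * s).2 (hpq h)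
    exact (‹p.IsPrime›.mem_or_mem hxa).resolve_left hx

theorem restrictionBijective_localized_quotient [IsNoetherianRing R] {p q : Ideal R} [p.IsPrime]
    [q.IsPrime] (hpq : p ≤ q) {x : R} (hxp : x ∉ p) (hxq : x ∈ q)
    (hq : q ∉ associatedPrimes R (R ⧸ (p ⊔ Ideal.span {x}))) :
    RestrictionBijective q (LocalizedModule q.primeCompl (R ⧸ p)) := by
  refine ⟨fun m hm => smul_eq_zero_of_notMem_prime hpq hxp (hm x hxq), fun φ => ?_⟩
  obtain ⟨m, s, hms⟩ : ∃ m s, φ ⟨x, hxq⟩ = LocalizedModule.mk m s := by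
    induction φ ⟨x, hxq⟩ using LocalizedModule.induction_on with
    | h m s => exact ⟨m, s, rfl⟩
  obtain ⟨a, rfl⟩ := Ideal.Quotient.mk_surjective m
  have hφ (r : q) : x • φ r = (r : R) • LocalizedModule.mk (Ideal.Quotient.mk p a) s := by
    rw [← hms, ← map_smul, ← map_smul]
    congr 1
    exact Subtype.ext (mul_comm _ _)
  obtain ⟨t, htS, ht⟩ : ∃ t ∈ q.primeCompl, ∀ r ∈ q,
      t * r ∈ Submodule.colon (p ⊔ Ideal.span {x}) {a} := by
    refine Ideal.FG.exists_mul_mem_of_forall_exists_mul_mem (IsNoetherian.noetherian q) _ fun r hr => ?_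
    have hr' := hφ ⟨r, hr⟩
    generalize φ ⟨r, hr⟩ = z at hr'
    induction z using LocalizedModule.induction_on with
    | h n v =>
      obtain ⟨b, rfl⟩ := Ideal.Quotient.mk_surjective n
      rw [LocalizedModule.smul'_mk, LocalizedModule.smul'_mk, LocalizedModule.mk_eq] at hr'
      obtain ⟨u, hu⟩ := hr'
      refine ⟨u * v, (u * v).2, ?_⟩
      have hmem : (u : R) * (s * (x * b)) - u * (v * (r * a)) ∈ p :=
        Ideal.Quotient.eq.1 hu
      rw [Submodule.mem_colon_singleton, smul_eq_mul,
        show (u * v : R) * r * a = -((u : R) * (s * (x * b)) - u * (v * (r * a))) +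
          (u * s * b) * x by ring]
      exact add_mem (Ideal.mem_sup_left (neg_mem hmem))
        (Ideal.mem_sup_right (Ideal.mul_mem_left _ _ (Ideal.mem_span_singleton_self x)))
  obtain ⟨u, huS, hu⟩ : ∃ u ∈ q.primeCompl, u * (t * a) ∈ p ⊔ Ideal.span {x} := by
    by_contra! hu
    refine hq (isAssociatedPrime_iff.2 ⟨‹_›, Ideal.Quotient.mk _ (t * a), ?_⟩)
    ext r
    have hiff : r ∈ Submodule.colon (⊥ : Submodule R (R ⧸ (p ⊔ Ideal.span {x})))
        {Ideal.Quotient.mk _ (t * a)} ↔ r * (t * a) ∈ p ⊔ Ideal.span {x} := by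
      rw [Submodule.mem_colon_singleton, Submodule.mem_bot, ← Ideal.Quotient.eq_zero_iff_mem]
      rfl
    rw [hiff]
    refine ⟨fun hr => ?_, fun hr => by_contra fun h => hu r h hr⟩
    have := ht r hr
    rw [Submodule.mem_colon_singleton, smul_eq_mul] at this
    rwa [mul_left_comm, ← mul_assoc]
  obtain ⟨d, hd, e, he, hde⟩ := Submodule.mem_sup.1 hu
  obtain ⟨c, rfl⟩ := Ideal.mem_span_singleton.1 he
  let w : q.primeCompl := ⟨u, huS⟩ * ⟨t, htS⟩
  have hy : LocalizedModule.mk (Ideal.Quotient.mk p a) s =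
      x • LocalizedModule.mk (Ideal.Quotient.mk p c) (w * s) := by
    rw [LocalizedModule.smul'_mk, LocalizedModule.mk_eq]
    refine ⟨1, congrArg _ ?_⟩
    refine Ideal.Quotient.eq.2 (?_ : (u * t * s) * a - s * (x * c) ∈ p)
    rw [show (u * t * s : R) * a - s * (x * c) = s * d by linear_combination -(s : R) * hde]
    exact p.mul_mem_left _ hd
  refine ⟨LocalizedModule.mk (Ideal.Quotient.mk p c) (w * s), fun r => ?_⟩
  refine sub_eq_zero.1 (smul_eq_zero_of_notMem_prime hpq hxp ?_)
  rw [smul_sub, hφ, hy, smul_comm, sub_self]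

/-- If the localization at `q` of the ideal of `R ⧸ p` generated by `q` had bijective restriction
map, the inclusion of `q` would be multiplication by an element of `q`. -/
theorem not_restrictionBijective_localized_map {p q : Ideal R} [p.IsPrime] [q.IsPrime]
    (hpq : p < q) :
    ¬ RestrictionBijective q
      (LocalizedModule q.primeCompl (Submodule.map (Submodule.mkQ p) q)) := by
  intro h
  let f : q →ₗ[R] Submodule.map (Submodule.mkQ p) q := (Submodule.mkQ p).submoduleMap q
  obtain ⟨z, hz⟩ := h.2 (LocalizedModule.mkLinearMap q.primeCompl _ ∘ₗ f)
  obtain ⟨x, hxq, hxp⟩ := SetLike.exists_of_lt hpq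
  have hx := hz ⟨x, hxq⟩
  induction z using LocalizedModule.induction_on with
  | h n s =>
    obtain ⟨_, b, hb, rfl⟩ := n
    rw [LocalizedModule.smul'_mk, LinearMap.comp_apply, LocalizedModule.mkLinearMap_apply,
      LocalizedModule.mk_eq] at hx
    obtain ⟨u, hu⟩ := hx
    have hmem : (u : R) * (s * x) - u * (1 * (x * b)) ∈ p :=
      Ideal.Quotient.eq.1 (congrArg Subtype.val hu)
    rw [show (u : R) * (s * x) - u * (1 * (x * b)) = u * (s - b) * x by ring] at hmem
    rcases ‹p.IsPrime›.mem_or_mem ((‹p.IsPrime›.mem_or_mem hmem).resolve_right hxp) with h1 | h1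
    · exact u.2 (hpq.le h1)
    · exact s.2 ((q.sub_mem_iff_left hb).1 (hpq.le h1))

/-- Between the ends of a chain of three primes of a noetherian ring, a prime strictly below the
top one can be chosen outside any given finite set. -/
theorem exists_prime_between_notMem_finite [IsNoetherianRing R] {p₁ p₂ p₃ : Ideal R}
    [p₁.IsPrime] [p₂.IsPrime] [p₃.IsPrime] (h₁₂ : p₁ < p₂) (h₂₃ : p₂ < p₃)
    {s : Set (Ideal R)} (hs : s.Finite) (hprime : ∀ p ∈ s, p.IsPrime) :
    ∃ q : Ideal R, q.IsPrime ∧ p₁ ≤ q ∧ q ∉ s := by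
  obtain ⟨y, hy₃, hy⟩ : ∃ y ∈ p₃, ∀ p ∈ s, p < p₃ → y ∉ p := by
    have hfin : {p ∈ s | p < p₃}.Finite := hs.subset fun p hp => hp.1
    have := (Ideal.subset_union_prime_finite hfin (f := id) (I := p₃) ⊥ ⊥
      fun p hp _ _ => hprime p hp.1).not.2 (by rintro ⟨p, hp, hle⟩; exact hp.2.not_ge hle)
    obtain ⟨y, hy₃, hy⟩ := Set.not_subset.1 this
    exact ⟨y, hy₃, fun p hp hlt hyp => hy (Set.mem_biUnion (show p ∈ {p ∈ s | p < p₃} from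
      ⟨hp, hlt⟩) hyp)⟩
  have hle : Ideal.span (insert y (p₁ : Set R)) ≤ p₃ :=
    Ideal.span_le.2 (Set.insert_subset hy₃ (h₁₂.trans h₂₃).le)
  obtain ⟨q, hq, hq₃⟩ := Ideal.exists_minimalPrimes_le hle
  have hins : insert y (p₁ : Set R) ⊆ q := Ideal.span_le.1 hq.1.2
  refine ⟨q, hq.1.1, (Set.subset_insert _ _).trans hins, fun hqs => ?_⟩
  refine hy q hqs (hq₃.lt_of_ne ?_) (hins (Set.mem_insert _ _))
  rintro rfl
  have hmin := Ideal.mem_minimalPrimes_span_of_mem_minimalPrimes_span_insert h₂₃ y p₁ hq p₁ h₁₂.le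
    ((Set.subset_insert _ _).trans (Ideal.subset_span.trans Ideal.le_radical))
  rw [Ideal.span_eq] at hmin
  exact h₁₂.not_ge (hmin.2 ⟨‹_›, le_rfl⟩ h₁₂.le)

end PrimeQuotient

theorem dim_le_two_of_KE_eq_torsionFree (R : Type u) [CommRing R]
    [IsNoetherianRing R]
    (h : ∀ P : ModuleCat.{u} R → Prop, MIsKEClosed R P → MIsTorsionFreeClass R P) :
    ringKrullDim R ≤ 2 := by
  by_contra hdim
  have h₃ : ((3 : ℕ) : WithBot ℕ∞) ≤ ringKrullDim R := ENat.WithBot.add_one_le_iff.2 (not_le.1 hdim)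
  obtain ⟨l, hl⟩ := Order.le_krullDim_iff.1 h₃
  have hlt (i j : Fin (l.length + 1)) (hij : i < j) : (l i).asIdeal < (l j).asIdeal :=
    l.strictMono hij
  have h₀₁ := hlt ⟨0, by omega⟩ ⟨1, by omega⟩ (by simp [Fin.lt_def])
  obtain ⟨x, hx₁, hx₀⟩ := SetLike.exists_of_lt h₀₁
  set p := (l ⟨0, by omega⟩).asIdeal
  obtain ⟨q, hqp, h₁q, hq⟩ := exists_prime_between_notMem_finite
    (hlt ⟨1, by omega⟩ ⟨2, by omega⟩ (by simp [Fin.lt_def])) (hlt ⟨2, by omega⟩ ⟨3, by omega⟩ (by simp [Fin.lt_def]))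
    (associatedPrimes.finite R (R ⧸ (p ⊔ Ideal.span {x}))) fun _ hp => hp.isPrime
  have hpq : p < q := h₀₁.trans_le h₁q
  have hmem : localDepthTwo q (ModuleCat.of R (R ⧸ p)) :=
    ⟨inferInstanceAs (Module.Finite R (R ⧸ p)),
      restrictionBijective_localized_quotient hpq.le hx₀ (h₁q hx₁) hq⟩
  have htf := h _ (localDepthTwo.mIsKEClosed q)
  exact not_restrictionBijective_localized_map hpq
    (htf.2.2.1 _ (Submodule.map (Submodule.mkQ p) q) hmem).2
end

section
/- Let R be a noetherian normal domain with Krull dimension dim R ≤ 2, and let X be a KE-closed subcategory of mod R such that the zero ideal (0) does not belong to Ass X. Then X is a torsion-free class of mod R. -/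
/-! Statement 9: Let `R` be a noetherian normal domain (an integrally closed
noetherian integral domain) with `dim R ≤ 2`, and let `X` be a KE-closed
subcategory of `mod R` such that the zero ideal does not belong to `Ass X`.
Then `X` is a torsion-free class of `mod R`. -/

open CategoryTheory

universe u

section Aux

variable {R : Type u} [CommRing R] {X : ModuleCat.{u} R → Prop}

/-- In a noetherian module, every property of submodules that holds somewhere has a maximal
witness. -/
lemma exists_maximal_submodule {M : Type*} [AddCommGroup M] [Module R M] [IsNoetherian R M]
    (P : Submodule R M → Prop) (N₀ : Submodule R M) (h₀ : P N₀) :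
    ∃ N, P N ∧ ∀ N', P N' → ¬ N < N' :=
  set_has_maximal_iff_noetherian.mpr ‹_› {N | P N} ⟨N₀, h₀⟩

lemma mem_associatedPrimes_iff_smul_eq_zero [IsNoetherianRing R] {M : Type*} [AddCommGroup M]
    [Module R M] {p : Ideal R} :
    p ∈ associatedPrimes R M ↔ p.IsPrime ∧ ∃ x : M, ∀ r, r ∈ p ↔ r • x = 0 := by
  rw [AssociatedPrimes.mem_iff, isAssociatedPrime_iff]
  simp [SetLike.ext_iff, Submodule.mem_colon_singleton]

namespace MIsKEClosed

variable {L M N : Type u} [AddCommGroup L] [Module R L] [AddCommGroup M] [Module R M]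
  [AddCommGroup N] [Module R N]

lemma of_equiv (hX : MIsKEClosed R X) (e : M ≃ₗ[R] N) (h : X (.of R M)) : X (.of R N) :=
  hX.2.1.2.1 _ _ e h

lemma left_of_exact (hX : MIsKEClosed R X) (f : L →ₗ[R] M) (g : M →ₗ[R] N)
    (hf : Function.Injective f) (hfg : Function.Exact f g) (hM : X (.of R M))
    (hN : X (.of R N)) : X (.of R L) := by
  refine hX.of_equiv ?_ (hX.2.2.1 (.of R M) (.of R N) g hM hN)
  exact (LinearEquiv.ofEq _ _ hfg.linearMap_ker_eq).trans (LinearEquiv.ofInjective f hf).symm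

lemma middle_of_exact (hX : MIsKEClosed R X) (f : L →ₗ[R] M) (g : M →ₗ[R] N)
    (hf : Function.Injective f) (hfg : Function.Exact f g) (hg : Function.Surjective g)
    (hL : X (.of R L)) (hN : X (.of R N)) : X (.of R M) := by
  refine hX.2.2.2 (.of R M) (LinearMap.range f) ?_ ?_
  · exact hX.of_equiv (LinearEquiv.ofInjective f hf) hL
  · refine hX.of_equiv ?_ hN
    exact ((Submodule.quotEquivOfEq _ _ hfg.linearMap_ker_eq.symm).trans
      (g.quotKerEquivOfSurjective hg)).symm

lemma left_of_prod (hX : MIsKEClosed R X) (h : X (.of R (M × N))) : X (.of R M) := by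
  refine hX.left_of_exact (LinearMap.inl R M N) (LinearMap.inr R M N ∘ₗ LinearMap.snd R M N)
    LinearMap.inl_injective ?_ h h
  rintro ⟨a, b⟩
  simp [Prod.ext_iff, eq_comm]

lemma of_subsingleton (hX : MIsKEClosed R X) [Subsingleton M] : X (.of R M) :=
  hX.2.1.1 (.of R M) ‹_›

lemma prod (hX : MIsKEClosed R X) (hM : X (.of R M)) (hN : X (.of R N)) :
    X (.of R (M × N)) :=
  hX.2.1.2.2 _ _ hM hN

lemma fin_pi (hX : MIsKEClosed R X) (hM : X (.of R M)) (n : ℕ) : X (.of R (Fin n → M)) := by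
  induction n with
  | zero => exact hX.of_subsingleton
  | succ n ih => exact hX.of_equiv (Fin.consLinearEquiv R fun _ : Fin (n + 1) ↦ M) (hX.prod hM ih)

lemma of_fin_pi (hX : MIsKEClosed R X) {n : ℕ} (hn : n ≠ 0) (h : X (.of R (Fin n → M))) :
    X (.of R M) := by
  obtain ⟨n, rfl⟩ := Nat.exists_eq_succ_of_ne_zero hn
  exact hX.left_of_prod (hX.of_equiv (Fin.consLinearEquiv R fun _ : Fin (n + 1) ↦ M).symm h)

/-- A KE-closed subcategory is closed under `Hom(F, -)` for finitely generated `F`. -/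
lemma linearMap [IsNoetherianRing R] (hX : MIsKEClosed R X) (F : Type u) [AddCommGroup F]
    [Module R F] [Module.Finite R F] (hM : X (.of R M)) : X (.of R (F →ₗ[R] M)) := by
  obtain ⟨n, π, hπ⟩ := Module.Finite.exists_fin' R F
  obtain ⟨m, k, hk⟩ := Module.Finite.exists_fin' R (LinearMap.ker π)
  have free (l : ℕ) : X (.of R ((Fin l → R) →ₗ[R] M)) :=
    hX.of_equiv ((Pi.basisFun R (Fin l)).constr R) (hX.fin_pi hM l)
  refine hX.left_of_exact (π.lcomp R M) (((LinearMap.ker π).subtype ∘ₗ k).lcomp R M)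
    (LinearMap.lcomp_injective_of_surjective π hπ)
    (LinearMap.exact_lcomp_of_exact_of_surjective _ ?_ hπ) (free n) (free m)
  rw [LinearMap.exact_iff, LinearMap.range_comp, LinearMap.range_eq_top.mpr hk]
  simp

/-- Let `q` be maximal and let `M` contain `L` with `q M ⊆ L`, where `M` has no nonzero elements
killed by `q`. Then `M` lies in every KE-closed subcategory containing `L`. -/
lemma of_isMaximal_smul_le [IsNoetherianRing R] (hX : MIsKEClosed R X) (q : Ideal R)
    [q.IsMaximal] (L : Submodule R M) (hL : X (.of R L)) (hqL : ∀ b ∈ q, ∀ x : M, b • x ∈ L)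
    (hq : ∀ x : M, (∀ b ∈ q, b • x = 0) → x = 0) : X (.of R M) := by
  let ι : M →ₗ[R] q →ₗ[R] L :=
    { toFun := fun x ↦
        { toFun := fun b ↦ ⟨b.1 • x, hqL _ b.2 x⟩
          map_add' := fun b c ↦ by ext; simp [add_smul]
          map_smul' := fun r b ↦ by ext; simp [mul_smul] }
      map_add' := fun x y ↦ by ext; simp
      map_smul' := fun r x ↦ by ext b; exact smul_comm b.1 r x }
  have hι (x : M) (b : q) : (ι x b : M) = b.1 • x := rfl
  have ι_inj : Function.Injective ι := by
    refine (injective_iff_map_eq_zero ι).mpr fun x hx ↦ hq x fun b hb ↦ ?_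
    rw [← hι x ⟨b, hb⟩, hx]; rfl
  have hH : X (.of R (q →ₗ[R] L)) := hX.linearMap q hL
  let L₁ : Submodule R (q →ₗ[R] L) := L.map ι
  have tors : Module.IsTorsionBySet R ((q →ₗ[R] L) ⧸ L₁) q := by
    intro x b
    obtain ⟨φ, rfl⟩ := L₁.mkQ_surjective x
    rw [← map_smul, Submodule.mkQ_apply, Submodule.Quotient.mk_eq_zero]
    refine ⟨φ b, (φ b).2, ?_⟩
    ext c
    have : b.1 • φ c = c.1 • φ b := by
      rw [← map_smul, ← map_smul]; congr 1; ext; simp [mul_comm]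
    rw [hι, LinearMap.smul_apply, this]; rfl
  let := tors.module
  let : Field (R ⧸ q) := Ideal.Quotient.field q
  have ss : IsSemisimpleModule R ((q →ₗ[R] L) ⧸ L₁) :=
    tors.isSemisimpleModule_iff.mp inferInstance
  obtain ⟨C, hC⟩ := exists_isCompl ((LinearMap.range ι).map L₁.mkQ)
  let M₂ := C.comap L₁.mkQ
  have L₁_le₂ : L₁ ≤ M₂ := fun x hx ↦ by
    change L₁.mkQ x ∈ C
    rw [Submodule.mkQ_apply, (Submodule.Quotient.mk_eq_zero _).mpr hx]; exact C.zero_mem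
  have inf_le : ∀ x : M, ι x ∈ M₂ → x ∈ L := fun x hx ↦ by
    have : L₁.mkQ (ι x) = 0 :=
      (Submodule.disjoint_def.mp hC.disjoint) _ ⟨_, ⟨x, rfl⟩, rfl⟩ hx
    rw [Submodule.mkQ_apply, Submodule.Quotient.mk_eq_zero] at this
    obtain ⟨y, hy, hyx⟩ := this
    exact ι_inj hyx ▸ hy
  let g : M × M₂ →ₗ[R] q →ₗ[R] L := ι.coprod (-M₂.subtype)
  let f : L →ₗ[R] M × M₂ := LinearMap.prod L.subtype
    ((ι ∘ₗ L.subtype).codRestrict M₂ fun x ↦ L₁_le₂ ⟨x, x.2, rfl⟩)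
  refine hX.left_of_prod (N := M₂) (hX.middle_of_exact f g ?_ ?_ ?_ hL hH)
  · intro x y hxy
    exact Subtype.ext (congrArg Prod.fst hxy)
  · rintro ⟨x, y⟩
    constructor
    · intro h
      have hy : ι x = y := add_neg_eq_zero.mp h
      exact ⟨⟨x, inf_le x (hy ▸ y.2)⟩, Prod.ext rfl (Subtype.ext hy)⟩
    · rintro ⟨z, hz⟩
      rw [← hz]
      simp [f, g]
  · intro φ
    have : L₁.mkQ φ ∈ (LinearMap.range ι).map L₁.mkQ ⊔ C := hC.sup_eq_top ▸ Submodule.mem_top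
    obtain ⟨_, ⟨_, ⟨x, rfl⟩, rfl⟩, c, hc, h⟩ := Submodule.mem_sup.mp this
    refine ⟨(x, ⟨ι x - φ, ?_⟩), by simp [g]⟩
    change L₁.mkQ _ ∈ C
    rw [map_sub, ← h]
    simpa using C.neg_mem hc

/-- A submodule of finite colength in an `R ⧸ p`-torsion-free module, where `R ⧸ p` has dimension
at most one, forces the whole module into a KE-closed subcategory. -/
lemma of_torsion_quotient [IsNoetherianRing R] [Module.Finite R M] (hX : MIsKEClosed R X)
    (p : Ideal R) (hmax : ∀ q : Ideal R, q.IsPrime → p < q → q.IsMaximal)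
    (hp : ∀ b ∈ p, ∀ x : M, b • x = 0) (htf : ∀ a ∉ p, ∀ x : M, a • x = 0 → x = 0)
    (L : Submodule R M) (hL : X (.of R L)) (htors : ∀ x : M, ∃ a ∉ p, a • x ∈ L) :
    X (.of R M) := by
  obtain ⟨P, ⟨hP, hLP⟩, hPmax⟩ :=
    exists_maximal_submodule (fun P : Submodule R M ↦ X (.of R P) ∧ L ≤ P) L ⟨hL, le_rfl⟩
  by_cases hT : P = ⊤
  · subst hT
    exact hX.of_equiv Submodule.topEquiv hP
  have : Nontrivial (M ⧸ P) := Submodule.Quotient.nontrivial_iff.mpr hT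
  obtain ⟨q, hq⟩ := associatedPrimes.nonempty R (M ⧸ P)
  obtain ⟨hqp, x, hx⟩ := mem_associatedPrimes_iff_smul_eq_zero.mp hq
  obtain ⟨x, rfl⟩ := P.mkQ_surjective x
  replace hx (b : R) : b ∈ q ↔ b • x ∈ P := by
    rw [hx, ← map_smul, Submodule.mkQ_apply, Submodule.Quotient.mk_eq_zero]
  obtain ⟨a, hap, ha⟩ := htors x
  have haq : a ∈ q := (hx a).mpr (hLP ha)
  have hpq : p < q := SetLike.lt_iff_le_and_exists.mpr
    ⟨fun b hb ↦ (hx b).mpr ((hp b hb x).symm ▸ P.zero_mem), a, haq, hap⟩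
  have := hmax q hqp hpq
  have hxP : x ∉ P := fun h ↦ hqp.ne_top (q.eq_top_iff_one.mpr ((hx 1).mpr (by simpa using h)))
  let P' := P ⊔ Submodule.span R {x}
  have hPP' : P ≤ P' := le_sup_left
  have hlt : P < P' := SetLike.lt_iff_le_and_exists.mpr
    ⟨hPP', x, Submodule.mem_sup_right (Submodule.mem_span_singleton_self x), hxP⟩
  refine (hPmax P' ⟨?_, hLP.trans hPP'⟩ hlt).elim
  refine hX.of_isMaximal_smul_le q (P.comap P'.subtype)
    (hX.of_equiv (Submodule.comapSubtypeEquivOfLe hPP').symm hP) ?_ ?_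
  · rintro b hb ⟨y, hy⟩
    obtain ⟨z, hz, w, hw, rfl⟩ := Submodule.mem_sup.mp hy
    obtain ⟨r, rfl⟩ := Submodule.mem_span_singleton.mp hw
    change b • (z + r • x) ∈ P
    rw [smul_add, smul_comm]
    exact P.add_mem (P.smul_mem _ hz) (P.smul_mem _ ((hx b).mp hb))
  · intro y hy
    exact Subtype.ext (htf a hap y (congrArg Subtype.val (hy a haq)))

end MIsKEClosed

/-- Two finitely generated torsion-free modules over a noetherian domain become commensurable after
taking suitable finite powers. -/
lemma exists_injective_fin_pi_of_torsionFree {A K M : Type*} [CommRing A] [IsDomain A]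
    [IsNoetherianRing A] [AddCommGroup K] [Module A K] [Module.Finite A K] [Nontrivial K]
    [AddCommGroup M] [Module A M] [Module.Finite A M]
    (hK : ∀ a : A, a ≠ 0 → ∀ x : K, a • x = 0 → x = 0)
    (hM : ∀ a : A, a ≠ 0 → ∀ x : M, a • x = 0 → x = 0) :
    ∃ (s r : ℕ) (f : (Fin s → K) →ₗ[A] (Fin r → M)), r ≠ 0 ∧ Function.Injective f ∧
      ∀ y : Fin r → M, ∃ a : A, a ≠ 0 ∧ a • y ∈ LinearMap.range f := by
  let S := nonZeroDivisors A
  let F := FractionRing A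
  let K' := LocalizedModule S K
  let M' := LocalizedModule S M
  let : Module F K' := inferInstanceAs (Module (Localization S) (LocalizedModule S K))
  let : Module F M' := inferInstanceAs (Module (Localization S) (LocalizedModule S M))
  have : IsScalarTower A F K' :=
    inferInstanceAs (IsScalarTower A (Localization S) (LocalizedModule S K))
  have : IsScalarTower A F M' :=
    inferInstanceAs (IsScalarTower A (Localization S) (LocalizedModule S M))
  have : Module.Finite F K' :=
    Module.Finite.of_isLocalizedModule S (Rₚ := F) (LocalizedModule.mkLinearMap S K)
  have : Module.Finite F M' :=
    Module.Finite.of_isLocalizedModule S (Rₚ := F) (LocalizedModule.mkLinearMap S M)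
  let s := Module.finrank F M'
  let r := Module.finrank F K'
  have hr : r ≠ 0 := by
    obtain ⟨x, hx⟩ := exists_ne (0 : K)
    have : Nontrivial K' := by
      refine ⟨LocalizedModule.mkLinearMap S K x, 0, fun h ↦ hx ?_⟩
      obtain ⟨c, hc⟩ := (IsLocalizedModule.eq_zero_iff S _).mp h
      exact hK c (nonZeroDivisors.coe_ne_zero c) x hc
    exact Module.finrank_pos.ne'
  let e : (Fin s → K') ≃ₗ[F] (Fin r → M') := LinearEquiv.ofFinrankEq _ _ (by
    rw [Module.finrank_pi_fintype, Module.finrank_pi_fintype]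
    simp [s, r, mul_comm])
  let lK : (Fin s → K) →ₗ[A] (Fin s → K') :=
    .pi fun i ↦ LocalizedModule.mkLinearMap S K ∘ₗ .proj i
  let lM : (Fin r → M) →ₗ[A] (Fin r → M') :=
    .pi fun i ↦ LocalizedModule.mkLinearMap S M ∘ₗ .proj i
  have : IsLocalizedModule S lK := inferInstance
  have : IsLocalizedModule S lM := inferInstance
  have lK_inj (x) (h : lK x = 0) : x = 0 := by
    obtain ⟨c, hc⟩ := (IsLocalizedModule.eq_zero_iff S lK).mp h
    exact funext fun i ↦ hK c (nonZeroDivisors.coe_ne_zero c) _ (congrFun hc i)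
  have lM_inj (x) (h : lM x = 0) : x = 0 := by
    obtain ⟨c, hc⟩ := (IsLocalizedModule.eq_zero_iff S lM).mp h
    exact funext fun i ↦ hM c (nonZeroDivisors.coe_ne_zero c) _ (congrFun hc i)
  let e' : (Fin s → K') ≃ₗ[A] (Fin r → M') := e.restrictScalars A
  have := Module.finitePresentation_of_finite A (Fin s → K)
  obtain ⟨f, c, hf⟩ := Module.FinitePresentation.exists_lift_of_isLocalizedModule S lM
    (e'.toLinearMap ∘ₗ lK)
  replace hf (x) : lM (f x) = (c : A) • e' (lK x) := LinearMap.congr_fun hf x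
  have hc := nonZeroDivisors.coe_ne_zero c
  refine ⟨s, r, f, hr, (injective_iff_map_eq_zero f).mpr fun x hx ↦ ?_, fun y ↦ ?_⟩
  · refine funext fun i ↦ hK c hc _ (congrFun (lK_inj (c.1 • x) ?_) i)
    rw [← e'.map_eq_zero_iff, map_smul, map_smul, ← hf, hx, map_zero]
  · obtain ⟨⟨x, t⟩, hx⟩ := IsLocalizedModule.surj S lK (e'.symm (lM y))
    have ht := nonZeroDivisors.coe_ne_zero t
    refine ⟨c * t, mul_ne_zero hc ht, x, ?_⟩
    rw [← sub_eq_zero]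
    refine lM_inj _ ?_
    have hx' : (t : A) • e'.symm (lM y) = lK x := hx
    rw [map_sub, hf, ← hx', map_smul, map_smul, e'.apply_symm_apply, mul_smul, sub_self]

namespace MIsKEClosed

variable {L M N : Type u} [AddCommGroup L] [Module R L] [AddCommGroup M] [Module R M]
  [AddCommGroup N] [Module R N]

/-- When `R ⧸ p` has dimension at most one, a KE-closed subcategory containing a nonzero
torsion-free `R ⧸ p`-module contains all the finitely generated ones. -/
lemma of_torsionFree [IsNoetherianRing R] (hX : MIsKEClosed R X) (p : Ideal R) [p.IsPrime]
    (hmax : ∀ q : Ideal R, q.IsPrime → p < q → q.IsMaximal)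
    [Module.Finite R L] [Nontrivial L] (hpL : ∀ b ∈ p, ∀ x : L, b • x = 0)
    (hL : ∀ a ∉ p, ∀ x : L, a • x = 0 → x = 0) (hXL : X (.of R L))
    [Module.Finite R M] (hpM : ∀ b ∈ p, ∀ x : M, b • x = 0)
    (hM : ∀ a ∉ p, ∀ x : M, a • x = 0 → x = 0) : X (.of R M) := by
  have torsL : Module.IsTorsionBySet R L p := fun x b ↦ hpL b b.2 x
  have torsM : Module.IsTorsionBySet R M p := fun x b ↦ hpM b b.2 x
  let := torsL.module
  let := torsM.module
  have : IsScalarTower R (R ⧸ p) L := torsL.isScalarTower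
  have : IsScalarTower R (R ⧸ p) M := torsM.isScalarTower
  have : Module.Finite (R ⧸ p) L := .of_restrictScalars_finite R _ _
  have : Module.Finite (R ⧸ p) M := .of_restrictScalars_finite R _ _
  have notMem {a : R} (ha : Ideal.Quotient.mk p a ≠ 0) : a ∉ p :=
    fun h ↦ ha (Ideal.Quotient.eq_zero_iff_mem.mpr h)
  obtain ⟨s, r, f, hr, hf, hft⟩ :=
    exists_injective_fin_pi_of_torsionFree (A := R ⧸ p) (K := L) (M := M)
      (Ideal.Quotient.mk_surjective.forall.mpr fun a ha x hx ↦ hL a (notMem ha) x hx)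
      (Ideal.Quotient.mk_surjective.forall.mpr fun a ha x hx ↦ hM a (notMem ha) x hx)
  let g : (Fin s → L) →ₗ[R] (Fin r → M) := f.restrictScalars R
  refine hX.of_fin_pi hr (hX.of_torsion_quotient p hmax
    (fun b hb x ↦ funext fun i ↦ hpM b hb _)
    (fun a ha x hx ↦ funext fun i ↦ hM a ha _ (congrFun hx i)) (LinearMap.range g)
    (hX.of_equiv (LinearEquiv.ofInjective g hf) (hX.fin_pi hXL s)) fun y ↦ ?_)
  obtain ⟨a, ha, x, hx⟩ := hft y
  obtain ⟨a, rfl⟩ := Ideal.Quotient.mk_surjective a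
  exact ⟨a, notMem ha, x, hx⟩

/-- Suppose that for each `p ∈ Φ` the torsion-free `R ⧸ p`-modules lie in `X`. Then so do all the
finitely generated modules with associated primes in `Φ`. -/
lemma of_associatedPrimes_subset [IsNoetherianRing R] (hX : MIsKEClosed R X) (Φ : Set (Ideal R))
    (hΦ : ∀ p ∈ Φ, ∀ (Q : Type u) [AddCommGroup Q] [Module R Q] [Module.Finite R Q],
      (∀ b ∈ p, ∀ x : Q, b • x = 0) → (∀ a ∉ p, ∀ x : Q, a • x = 0 → x = 0) → X (.of R Q))
    [Module.Finite R M] (hM : associatedPrimes R M ⊆ Φ) : X (.of R M) := by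
  obtain ⟨P, ⟨hP, hPΦ⟩, hPmax⟩ := exists_maximal_submodule
    (fun P : Submodule R M ↦ X (.of R P) ∧ associatedPrimes R (M ⧸ P) ⊆ Φ) ⊥
    ⟨hX.of_subsingleton, (LinearEquiv.AssociatedPrimes.eq
      (Submodule.quotEquivOfEqBot (⊥ : Submodule R M) rfl)).trans_subset hM⟩
  by_cases hT : P = ⊤
  · subst hT
    exact hX.of_equiv Submodule.topEquiv hP
  have : Nontrivial (M ⧸ P) := Submodule.Quotient.nontrivial_iff.mpr hT
  obtain ⟨p, hp, hpmax⟩ := set_has_maximal_iff_noetherian.mpr ‹IsNoetherianRing R›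
    (associatedPrimes R (M ⧸ P)) (associatedPrimes.nonempty R (M ⧸ P))
  let Q := Submodule.torsionBySet R (M ⧸ P) p
  have hQ (x : M ⧸ P) : x ∈ Q ↔ ∀ b ∈ p, b • x = 0 := by
    simp [Q, Submodule.mem_torsionBySet_iff]
  have hXQ : X (.of R Q) := by
    refine hΦ p (hPΦ hp) Q (fun b hb x ↦ Subtype.ext ((hQ x).mp x.2 b hb)) fun a ha x hx ↦ ?_
    by_contra hx0
    obtain ⟨q, hq, hxq⟩ := exists_le_isAssociatedPrime_of_isNoetherianRing R x hx0
    have hlt : p < q := SetLike.lt_iff_le_and_exists.mpr ⟨fun b hb ↦ hxq ?_, a, hxq ?_, ha⟩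
    · exact hpmax q (hq.map_of_injective Q.subtype Q.injective_subtype) hlt
    · exact Submodule.mem_colon_singleton.mpr (Subtype.ext ((hQ x).mp x.2 b hb))
    · exact Submodule.mem_colon_singleton.mpr hx
  let P' := Q.comap P.mkQ
  have hPP' : P ≤ P' := P.le_comap_mkQ Q
  have hlt : P < P' := by
    obtain ⟨hpp, x, hx⟩ := mem_associatedPrimes_iff_smul_eq_zero.mp hp
    obtain ⟨x, rfl⟩ := P.mkQ_surjective x
    refine SetLike.lt_iff_le_and_exists.mpr ⟨hPP', x, (hQ _).mpr fun b hb ↦ (hx b).mp hb, ?_⟩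
    intro h
    refine hpp.ne_top ((Ideal.eq_top_iff_one p).mpr ((hx 1).mpr ?_))
    rwa [one_smul, Submodule.mkQ_apply, Submodule.Quotient.mk_eq_zero]
  refine (hPmax P' ⟨?_, ?_⟩ hlt).elim
  · refine hX.middle_of_exact (Submodule.inclusion hPP')
      (P.mkQ.restrict (p := P') (q := Q) fun _ h ↦ h) (Submodule.inclusion_injective hPP') ?_ ?_
      hP hXQ
    · rintro ⟨x, hx⟩
      simp [Subtype.ext_iff, Submodule.inclusion]
    · rintro ⟨y, hy⟩
      obtain ⟨x, rfl⟩ := P.mkQ_surjective y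
      exact ⟨⟨x, hy⟩, rfl⟩
  · intro q hq
    obtain ⟨hqp, x, hx⟩ := mem_associatedPrimes_iff_smul_eq_zero.mp hq
    obtain ⟨x, rfl⟩ := P'.mkQ_surjective x
    replace hx (b : R) : b ∈ q ↔ ∀ c ∈ p, b • c • P.mkQ x = 0 := by
      rw [hx, ← map_smul, Submodule.mkQ_apply, Submodule.Quotient.mk_eq_zero]
      change P.mkQ (b • x) ∈ Q ↔ _
      simp only [hQ, map_smul, smul_comm b]
    obtain ⟨S, hS⟩ := (isNoetherianRing_iff_ideal_fg R).mp ‹_› p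
    have hSp : ∀ c ∈ S, c ∈ p := fun c hc ↦ hS ▸ Submodule.subset_span hc
    obtain ⟨c, hcS, hc⟩ := (hqp.inf_le' (s := S)
      (f := fun c ↦ (⊥ : Submodule R (M ⧸ P)).colon {c • P.mkQ x})).mp fun b hb ↦ by
        rw [hx]
        intro c hc
        have hpb : p ≤ (⊥ : Submodule R (M ⧸ P)).colon {b • P.mkQ x} := by
          rw [← hS, Ideal.span_le]
          intro c hc
          have := (Submodule.mem_finsetInf.mp hb) c hc
          rw [Submodule.mem_colon_singleton, Submodule.mem_bot] at this
          rw [SetLike.mem_coe, Submodule.mem_colon_singleton, Submodule.mem_bot, smul_comm, this]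
        rw [smul_comm]
        exact Submodule.mem_colon_singleton.mp (hpb hc)
    refine hPΦ (mem_associatedPrimes_iff_smul_eq_zero.mpr ⟨hqp, c • P.mkQ x, fun b ↦
      ⟨fun hb ↦ (hx b).mp hb c (hSp c hcS), fun hb ↦ hc (Submodule.mem_colon_singleton.mpr hb)⟩⟩)

/-- For `p ∈ Ass X` with `R ⧸ p` of dimension at most one, `X` contains a nonzero torsion-free
`R ⧸ p`-module, provided that `X` contains the modules supported at its maximal associated
primes. -/
lemma exists_torsionFree [IsNoetherianRing R] (hX : MIsKEClosed R X) (p : Ideal R)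
    (hp : p ∈ AssOf R X) (hmax : ∀ q : Ideal R, q.IsPrime → p < q → q.IsMaximal)
    (hfl : ∀ (Q : Type u) [AddCommGroup Q] [Module R Q] [Module.Finite R Q],
      associatedPrimes R Q ⊆ {q ∈ AssOf R X | p < q ∧ q.IsMaximal} → X (.of R Q)) :
    ∃ (K : Type u) (_ : AddCommGroup K) (_ : Module R K), Module.Finite R K ∧ Nontrivial K ∧
      (∀ b ∈ p, ∀ x : K, b • x = 0) ∧ (∀ a ∉ p, ∀ x : K, a • x = 0 → x = 0) ∧ X (.of R K) := by
  obtain ⟨M, hM, hpM⟩ := hp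
  have : Module.Finite R M := hX.1 M hM
  obtain ⟨hpp, m, hm⟩ := mem_associatedPrimes_iff_smul_eq_zero.mp hpM
  let H := (R ⧸ p) →ₗ[R] M
  have hXH : X (.of R H) := hX.linearMap (R ⧸ p) hM
  have hpH (b : R) (hb : b ∈ p) (x : H) : b • x = 0 := by
    ext
    change b • x (Submodule.Quotient.mk 1) = 0
    rw [← map_smul, ← Submodule.Quotient.mk_smul, (Submodule.Quotient.mk_eq_zero p).mpr, map_zero]
    exact p.mul_mem_right 1 hb
  let g : H := p.liftQ (LinearMap.toSpanSingleton R M m) fun b hb ↦ (hm b).mp hb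
  have hg (a : R) (ha : a • g = 0) : a ∈ p := by
    rw [hm]
    have : a • g (Submodule.Quotient.mk 1) = 0 := LinearMap.congr_fun ha _
    rwa [show g (Submodule.Quotient.mk 1) = m from one_smul R m] at this
  let T : Submodule R H :=
    { carrier := {x | ∃ a ∉ p, a • x = 0}
      zero_mem' := ⟨1, p.one_notMem, smul_zero 1⟩
      add_mem' := by
        rintro x y ⟨a, ha, hax⟩ ⟨b, hb, hby⟩
        refine ⟨a * b, hpp.mul_notMem ha hb, ?_⟩
        rw [smul_add, mul_comm, mul_smul, hax, mul_comm, mul_smul, hby]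
        simp
      smul_mem' := by
        rintro r x ⟨a, ha, hax⟩
        exact ⟨a, ha, by rw [smul_comm, hax, smul_zero]⟩ }
  obtain ⟨K, hK, hKmax⟩ := exists_maximal_submodule
    (fun K : Submodule R H ↦ Disjoint K T) ⊥ disjoint_bot_left
  rw [Submodule.disjoint_def] at hK
  refine ⟨K, inferInstance, inferInstance, inferInstance, ?_, fun b hb x ↦ Subtype.ext (hpH b hb x),
    fun a ha x hx ↦ Subtype.ext (hK x x.2 ⟨a, ha, congrArg Subtype.val hx⟩), ?_⟩
  · rw [Submodule.nontrivial_iff_ne_bot]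
    rintro rfl
    refine hKmax (Submodule.span R {g}) (Submodule.disjoint_def.mpr fun x hx ↦ ?_)
      (bot_lt_iff_ne_bot.mpr fun h ↦ ?_)
    · obtain ⟨r, rfl⟩ := Submodule.mem_span_singleton.mp hx
      rintro ⟨a, ha, har⟩
      rw [← mul_smul] at har
      exact hpH r ((hpp.mem_or_mem (hg _ har)).resolve_left ha) g
    · rw [Submodule.span_singleton_eq_bot] at h
      exact p.one_notMem (hg 1 (by rw [h, smul_zero]))
  · refine hX.left_of_exact K.subtype K.mkQ K.injective_subtype (LinearMap.exact_subtype_mkQ K) hXH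
      (hfl (H ⧸ K) fun q hq ↦ ?_)
    obtain ⟨hqp, z, hz⟩ := mem_associatedPrimes_iff_smul_eq_zero.mp hq
    obtain ⟨z, rfl⟩ := K.mkQ_surjective z
    replace hz (b : R) : b ∈ q ↔ b • z ∈ K := by
      rw [hz, ← map_smul, Submodule.mkQ_apply, Submodule.Quotient.mk_eq_zero]
    have hzK : z ∉ K := fun h ↦ q.one_notMem ((hz 1).mpr (by rwa [one_smul]))
    have hnd : ¬ Disjoint (K ⊔ Submodule.span R {z}) T := fun h ↦ hKmax _ h <|
      SetLike.lt_iff_le_and_exists.mpr ⟨le_sup_left, z,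
        Submodule.mem_sup_right (Submodule.mem_span_singleton_self z), hzK⟩
    simp only [Submodule.disjoint_def, not_forall] at hnd
    obtain ⟨t, ht, htT, ht0⟩ := hnd
    obtain ⟨k, hk, w, hw, rfl⟩ := Submodule.mem_sup.mp ht
    obtain ⟨r, rfl⟩ := Submodule.mem_span_singleton.mp hw
    have hrq : r ∉ q := fun h ↦ ht0 (hK _ (K.add_mem hk ((hz r).mp h)) htT)
    have hqt (b : R) : b ∈ q ↔ b • (k + r • z) = 0 := by
      constructor
      · intro hb
        refine hK _ ?_ (T.smul_mem b htT)
        rw [smul_add, smul_comm b r]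
        exact K.add_mem (K.smul_mem b hk) (K.smul_mem r ((hz b).mp hb))
      · intro hb
        rw [smul_add, ← mul_smul] at hb
        refine (hqp.mem_or_mem ((hz (b * r)).mpr ?_)).resolve_right hrq
        rw [← neg_eq_of_add_eq_zero_right hb]
        exact K.neg_mem (K.smul_mem b hk)
    obtain ⟨a, ha, hat⟩ := htT
    have hpq : p < q := SetLike.lt_iff_le_and_exists.mpr
      ⟨fun b hb ↦ (hqt b).mpr (hpH b hb _), a, (hqt a).mpr hat, ha⟩
    exact ⟨⟨.of R H, hXH, mem_associatedPrimes_iff_smul_eq_zero.mpr ⟨hqp, _, hqt⟩⟩, hpq,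
      hmax q hqp hpq⟩

/-- A KE-closed subcategory all of whose associated primes have coheight at most one contains every
finitely generated module with associated primes in `Ass X`. -/
lemma of_associatedPrimes_subset_assOf [IsNoetherianRing R] (hX : MIsKEClosed R X)
    (hmax : ∀ p ∈ AssOf R X, ∀ q : Ideal R, q.IsPrime → p < q → q.IsMaximal)
    [Module.Finite R M] (hM : associatedPrimes R M ⊆ AssOf R X) : X (.of R M) := by
  have step (p : Ideal R) (hp : p ∈ AssOf R X)
      (hfl : ∀ (Q : Type u) [AddCommGroup Q] [Module R Q] [Module.Finite R Q],
        associatedPrimes R Q ⊆ {q ∈ AssOf R X | p < q ∧ q.IsMaximal} → X (.of R Q))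
      (Q : Type u) [AddCommGroup Q] [Module R Q] [Module.Finite R Q]
      (hpQ : ∀ b ∈ p, ∀ x : Q, b • x = 0) (hQ : ∀ a ∉ p, ∀ x : Q, a • x = 0 → x = 0) :
      X (.of R Q) := by
    have : p.IsPrime := hp.choose_spec.2.isPrime
    obtain ⟨K, _, _, _, _, hpK, hK, hXK⟩ := hX.exists_torsionFree p hp (hmax p hp) hfl
    exact hX.of_torsionFree p (hmax p hp) hpK hK hXK hpQ hQ
  refine hX.of_associatedPrimes_subset _ (fun p hp ↦ step p hp fun Q _ _ _ hQ ↦ ?_) hM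
  refine hX.of_associatedPrimes_subset _ (fun q hq ↦ step q hq.1 fun W _ _ _ hW ↦ ?_) hQ
  have : associatedPrimes R W = ∅ := Set.eq_empty_of_forall_notMem fun r hr ↦
    (hW hr).2.2.ne_top (hq.2.2.1.2 r (hW hr).2.1)
  have : Subsingleton W := by
    by_contra h
    rw [not_subsingleton_iff_nontrivial] at h
    exact (associatedPrimes.nonempty R W).ne_empty this
  exact hX.of_subsingleton

end MIsKEClosed

/-- In a domain of dimension at most two, primes strictly above a nonzero prime are maximal. -/
lemma Ideal.isMaximal_of_lt_of_ringKrullDim_le_two [IsDomain R] (hdim : ringKrullDim R ≤ 2)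
    {p q : Ideal R} (hp0 : p ≠ ⊥) (hp : p.IsPrime) (hq : q.IsPrime) (hpq : p < q) :
    q.IsMaximal := by
  obtain ⟨m, hm, hqm⟩ := q.exists_le_maximal hq.ne_top
  obtain rfl | hlt := hqm.eq_or_lt
  · exact hm
  let l : LTSeries (PrimeSpectrum R) :=
    { length := 3
      toFun := ![⟨⊥, Ideal.isPrime_bot⟩, ⟨p, hp⟩, ⟨q, hq⟩, ⟨m, hm.isPrime⟩]
      step := fun i ↦ by
        fin_cases i
        exacts [bot_lt_iff_ne_bot.mpr hp0, hpq, hlt] }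
  have h : ((3 : ℕ) : WithBot ℕ∞) ≤ (2 : ℕ) := (Order.LTSeries.length_le_krullDim l).trans hdim
  exact absurd (WithBot.coe_le_coe.mp h) (by decide)

end Aux

theorem KE_is_torsionFree_of_normal_dim_le_two (R : Type u) [CommRing R]
    [IsDomain R] [IsNoetherianRing R] [IsIntegrallyClosed R]
    (hdim : ringKrullDim R ≤ 2)
    (X : ModuleCat.{u} R → Prop) (hX : MIsKEClosed R X)
    (h0 : (⊥ : Ideal R) ∉ AssOf R X) :
    MIsTorsionFreeClass R X := by
  refine ⟨hX.1, hX.2.1, fun M N hM ↦ ?_, hX.2.2.2⟩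
  have : Module.Finite R M := hX.1 M hM
  refine hX.of_associatedPrimes_subset_assOf (fun p hp q hq hpq ↦ ?_) fun p hp ↦
    ⟨M, hM, associatedPrimes.subset_of_injective N.injective_subtype hp⟩
  refine Ideal.isMaximal_of_lt_of_ringKrullDim_le_two hdim ?_ hp.choose_spec.2.isPrime hq hpq
  rintro rfl
  exact h0 hp
end

section
/- Let R be a commutative noetherian ring, M a finitely generated R-module, and suppose Ass M = Φ ⊔ Ψ is a decomposition of the set of associated primes of M into two disjoint subsets. Then there exists a short exact sequence 0 → L → M → N → 0 of finitely generated R-modules (i.e., a submodule L of M with N = M/L) such that Ass L = Φ and Ass N = Ψ. -/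
/-!
Statement 11: Let `R` be a commutative noetherian ring and `M` a finitely
generated `R`-module, and let `Ass M = Φ ⊔ Ψ` be a decomposition of the set
of associated primes of `M` into two disjoint subsets. Then there exists a
submodule `L ⊆ M` such that `Ass L = Φ` and `Ass (M/L) = Ψ`.
-/

universe u v

/-- If `L` is maximal among the submodules of `M` whose associated primes lie in `Φ`, then the
associated primes of `M ⧸ L` are associated primes of `M` that do not lie in `Φ`. -/
theorem associatedPrimes_quotient_subset_diff {R : Type u} [CommRing R] [IsNoetherianRing R]
    {M : Type v} [AddCommGroup M] [Module R M] {Φ : Set (Ideal R)} {L : Submodule R M}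
    (hL : Maximal (fun N : Submodule R M => associatedPrimes R N ⊆ Φ) L) :
    associatedPrimes R (M ⧸ L) ⊆ associatedPrimes R M \ Φ := by
  intro p hp
  obtain ⟨hpp, f, hf⟩ := (isAssociatedPrime_iff_exists_injective_linearMap p (M ⧸ L)).mp hp
  let N : Submodule R M := (LinearMap.range f).comap L.mkQ
  have hLN : L ≤ N := fun x hx => by
    simp [N, (Submodule.Quotient.mk_eq_zero L).mpr hx]
  let g : N →ₗ[R] LinearMap.range f := L.mkQ.restrict fun _ hx => hx
  have hexact : Function.Exact (Submodule.inclusion hLN) g := by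
    intro x
    rw [← Subtype.coe_inj]
    change L.mkQ (x : M) = 0 ↔ _
    rw [Submodule.mkQ_apply, Submodule.Quotient.mk_eq_zero]
    exact ⟨fun hx => ⟨⟨x, hx⟩, rfl⟩, by rintro ⟨y, rfl⟩; exact y.2⟩
  have hrange : associatedPrimes R (LinearMap.range f) = {p} := by
    rw [← LinearEquiv.AssociatedPrimes.eq (LinearEquiv.ofInjective f hf),
      associatedPrimes.eq_singleton_of_isPrimary hpp.isPrimary, hpp.radical]
  have hassN : associatedPrimes R N ⊆ associatedPrimes R L ∪ {p} :=
    hrange ▸ associatedPrimes.subset_union_of_exact (Submodule.inclusion_injective hLN) hexact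
  have hnot : ¬ associatedPrimes R N ⊆ Φ := by
    intro hN
    have hNL : N ≤ L := hL.2 hN hLN
    have hone : f 1 = 0 := by
      obtain ⟨x, hx⟩ := L.mkQ_surjective (f 1)
      rw [← hx, Submodule.mkQ_apply, Submodule.Quotient.mk_eq_zero]
      exact hNL ⟨1, hx.symm⟩
    have : Nontrivial (R ⧸ p) := Ideal.Quotient.nontrivial_iff.mpr hpp.ne_top
    exact one_ne_zero (hf (hone.trans (map_zero f).symm))
  obtain ⟨q, hqN, hqΦ⟩ := Set.not_subset.mp hnot
  obtain rfl : q = p := (hassN hqN).resolve_left fun hq => hqΦ (hL.1 hq)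
  exact ⟨associatedPrimes.subset_of_injective N.injective_subtype hqN, hqΦ⟩

theorem exists_submodule_ass_decomposition (R : Type u) [CommRing R]
    [IsNoetherianRing R] (M : Type v) [AddCommGroup M] [Module R M]
    [Module.Finite R M] (Φ Ψ : Set (Ideal R))
    (hunion : associatedPrimes R M = Φ ∪ Ψ) (hdisj : Disjoint Φ Ψ) :
    ∃ L : Submodule R M,
      associatedPrimes R L = Φ ∧ associatedPrimes R (M ⧸ L) = Ψ := by
  obtain ⟨L, hL⟩ : ∃ L, Maximal (fun N : Submodule R M => associatedPrimes R N ⊆ Φ) L := by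
    obtain ⟨L, hL, hmax⟩ := WellFounded.has_min (wellFounded_gt (α := Submodule R M))
      {N | associatedPrimes R N ⊆ Φ}
      ⟨⊥, by simp [associatedPrimes.eq_empty_of_subsingleton]⟩
    exact ⟨L, hL, fun N hN hle => not_not.mp fun h => hmax N hN (lt_of_le_not_ge hle h)⟩
  have hquot : associatedPrimes R (M ⧸ L) ⊆ Ψ := fun p hp => by
    obtain ⟨hpM, hpΦ⟩ := associatedPrimes_quotient_subset_diff hL hp
    exact (hunion ▸ hpM : p ∈ Φ ∪ Ψ).resolve_left hpΦ
  have hM : Φ ∪ Ψ ⊆ associatedPrimes R L ∪ associatedPrimes R (M ⧸ L) :=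
    hunion ▸ associatedPrimes.subset_union_of_exact L.injective_subtype
      (LinearMap.exact_subtype_mkQ L)
  refine ⟨L, hL.1.antisymm fun p hp => ?_, hquot.antisymm fun p hp => ?_⟩
  · exact (hM (Or.inl hp)).resolve_right fun h => Set.disjoint_left.mp hdisj hp (hquot h)
  · exact (hM (Or.inr hp)).resolve_left fun h => Set.disjoint_left.mp hdisj (hL.1 h) hp
end
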